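/- arXiv:2402.03718 — 2 statements merged into one kernel-verified Lean document; each statement's English description precedes it below -/
import Mathlib

section
/- Let A be the attractor of a holomorphic IFS (G, Ω_G), G = {g_i}_{i∈Λ}, satisfying the strong separation condition, let r > 0, and let h : B(a, r) → ℂ be a local holomorphic symmetry of A such that a ∈ A is an attracting fixed point of h. Then there exist l ∈ {1, …, K}, where K depends only on r and G, and finite words v, ṽ ∈ Λ*, such that h^l = g_v ∘ g_ṽ ∘ g_v^{-1} on some ball around the point a, where h^l is the l-th iterate of h. -/
open Set Metric

noncomputable section

/-- A finite holomorphic IFS: a bounded domain `Ω ⊂ ℂ` together with finitely many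
univalent maps `g i : Ω → Ω` with `closure (g i '' Ω) ⊆ Ω`. -/
structure HolIFS where
  /-- the number of maps -/
  m : ℕ
  hm : 1 ≤ m
  /-- the domain -/
  Ω : Set ℂ
  hopen : IsOpen Ω
  hconn : IsConnected Ω
  hbdd : Bornology.IsBounded Ω
  /-- the maps of the IFS -/
  g : Fin m → ℂ → ℂ
  hdiff : ∀ i, DifferentiableOn ℂ (g i) Ω
  hinj : ∀ i, Set.InjOn (g i) Ω
  hcl : ∀ i, closure (g i '' Ω) ⊆ Ω

/-- `A` is the attractor of the IFS `S`: the (unique) nonempty compact subset of `Ω`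
with `A = ⋃ i, g i '' A`. -/
def HolIFS.IsAttractor (S : HolIFS) (A : Set ℂ) : Prop :=
  A.Nonempty ∧ IsCompact A ∧ A ⊆ S.Ω ∧ A = ⋃ i, S.g i '' A

/-- The strong separation condition for the IFS `S` with attractor `A`. -/
def HolIFS.SSC (S : HolIFS) (A : Set ℂ) : Prop :=
  ∀ i j : Fin S.m, i ≠ j → Disjoint (S.g i '' A) (S.g j '' A)

/-- For a finite word `w = [i₁, …, i_k]`, the composition `g_w = g i₁ ∘ ⋯ ∘ g i_k`. -/
def HolIFS.word (S : HolIFS) (w : List (Fin S.m)) : ℂ → ℂ :=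
  w.foldr (fun i f => S.g i ∘ f) id

/-- `H` is a local holomorphic symmetry of the compact set `K` on the domain `D`. -/
def IsSymmetryOn (K D : Set ℂ) (H : ℂ → ℂ) : Prop :=
  DifferentiableOn ℂ H D ∧ ∀ x ∈ D, (x ∈ K ↔ H x ∈ K)

/-- An injective holomorphic function has nonvanishing derivative. -/
theorem deriv_ne_zero_of_injOn {f : ℂ → ℂ} {U : Set ℂ} (hU : IsOpen U)
    (hf : DifferentiableOn ℂ f U) (hinj : InjOn f U) {x : ℂ} (hx : x ∈ U) :
    deriv f x ≠ 0 := by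
  intro h0
  have hUx : U ∈ nhds x := hU.mem_nhds hx
  have han : AnalyticAt ℂ f x := hf.analyticAt hUx
  have hsub : AnalyticAt ℂ (fun z => f z - f x) x := han.sub analyticAt_const
  have hfin : analyticOrderAt (fun z => f z - f x) x ≠ ⊤ := by
    rw [Ne, analyticOrderAt_eq_top]
    intro h
    have h2 : ∀ᶠ z in nhdsWithin x {x}ᶜ, z ∈ U ∧ f z - f x = 0 ∧ z ≠ x := by
      filter_upwards [nhdsWithin_le_nhds hUx, nhdsWithin_le_nhds h, self_mem_nhdsWithin]
        with z h1 h2 h3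
      exact ⟨h1, h2, h3⟩
    obtain ⟨z, h1, h2, h3⟩ := h2.exists
    exact h3 (hinj h1 hx (sub_eq_zero.mp h2))
  obtain ⟨u, hu, hux, hfu⟩ := (hsub.analyticOrderAt_ne_top).1 hfin
  set n := analyticOrderNatAt (fun z => f z - f x) x with hn
  have hn0 : n ≠ 0 := by
    intro h
    have := hfu.self_of_nhds
    simp [h] at this
    exact hux this.symm
  have hn1 : n ≠ 1 := by
    intro h
    have hd : HasDerivAt (fun z => f x + (z - x) ^ n • u z) (u x) x := by
      have h1 : HasDerivAt (fun z => (z - x) * u z) (1 * u x + (x - x) * deriv u x) x :=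
        ((hasDerivAt_id x).sub_const x).mul hu.differentiableAt.hasDerivAt
      simpa [h] using h1.const_add (f x)
    have he : f =ᶠ[nhds x] (fun z => f x + (z - x) ^ n • u z) := by
      filter_upwards [hfu] with z hz
      rw [← hz]; ring
    exact hux (by rw [← hd.deriv, ← he.deriv_eq, h0])
  set v : ℂ → ℂ := fun z => (u z / u x) ^ ((n : ℂ)⁻¹) with hv
  have hvx : v x = 1 := by simp [hv, hux]
  have hq : AnalyticAt ℂ (fun z => u z / u x) x := hu.div analyticAt_const hux
  have hvan : AnalyticAt ℂ v x := by
    apply hq.cpow analyticAt_const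
    simp [hux]
  set φ : ℂ → ℂ := fun z => (z - x) * v z with hφ
  have hφan : AnalyticAt ℂ φ x := (analyticAt_id.sub analyticAt_const).mul hvan
  have hφd : deriv φ x = 1 := by
    have h1 : HasDerivAt φ (1 * v x + (x - x) * deriv v x) x :=
      ((hasDerivAt_id x).sub_const x).mul hvan.differentiableAt.hasDerivAt
    rw [h1.deriv, hvx]; ring
  have hmap : Filter.map φ (nhds x) = nhds (φ x) := by
    apply hφan.hasStrictDerivAt.map_nhds_eq
    rw [hφd]; exact one_ne_zero
  have hφx : φ x = 0 := by simp [hφ]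
  have hn2 : 2 ≤ n := by omega
  set ζ : ℂ := Complex.exp (2 * Real.pi * Complex.I / n) with hζ
  have hprim : IsPrimitiveRoot ζ n := Complex.isPrimitiveRoot_exp n hn0
  have hζ1 : ζ ≠ 1 := hprim.ne_one (by omega)
  have hgood : {z | z ∈ U ∧ f z - f x = u x * φ z ^ n} ∈ nhds x := by
    filter_upwards [hUx, hfu] with z h1 h2
    refine ⟨h1, ?_⟩
    rw [h2, hφ]
    simp only [smul_eq_mul, mul_pow, hv]
    rw [Complex.cpow_nat_inv_pow _ hn0]
    field_simp
  have himg : φ '' {z | z ∈ U ∧ f z - f x = u x * φ z ^ n} ∈ nhds (0 : ℂ) := by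
    rw [← hφx, ← hmap]; exact Filter.image_mem_map hgood
  have himg2 : (fun w => ζ * w) ⁻¹' (φ '' {z | z ∈ U ∧ f z - f x = u x * φ z ^ n}) ∈
      nhds (0 : ℂ) := by
    apply (continuous_const_mul ζ).continuousAt.preimage_mem_nhds
    simpa using himg
  have h2 : ∀ᶠ w in nhdsWithin (0 : ℂ) {0}ᶜ,
      w ∈ φ '' {z | z ∈ U ∧ f z - f x = u x * φ z ^ n} ∧
      ζ * w ∈ φ '' {z | z ∈ U ∧ f z - f x = u x * φ z ^ n} ∧ w ≠ 0 := by
    filter_upwards [nhdsWithin_le_nhds himg, nhdsWithin_le_nhds himg2, self_mem_nhdsWithin]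
      with w h1 h2 h3
    exact ⟨h1, h2, h3⟩
  obtain ⟨w, ⟨z1, ⟨h1U, h1⟩, rfl⟩, ⟨z2, ⟨h2U, h2⟩, h3⟩, hw⟩ := h2.exists
  have : z1 = z2 := by
    apply hinj h1U h2U
    have : f z1 - f x = f z2 - f x := by
      rw [h1, h2, h3, mul_pow ζ, hprim.pow_eq_one, one_mul]
    exact sub_left_injective this
  rw [← this] at h3
  exact hζ1 (mul_right_cancel₀ hw (by rw [one_mul]; exact h3.symm))

namespace HolIFS

variable {S : HolIFS} {A : Set ℂ}

theorem word_cons (i : Fin S.m) (w : List (Fin S.m)) :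
    S.word (i :: w) = S.g i ∘ S.word w := rfl

theorem word_append (u v : List (Fin S.m)) : S.word (u ++ v) = S.word u ∘ S.word v := by
  induction u with
  | nil => rfl
  | cons i u ih => rw [List.cons_append, word_cons, word_cons, ih]; rfl

theorem g_mapsTo (i : Fin S.m) : MapsTo (S.g i) S.Ω S.Ω := fun _ hx =>
  S.hcl i (subset_closure (mem_image_of_mem _ hx))

theorem word_mapsTo (w : List (Fin S.m)) : MapsTo (S.word w) S.Ω S.Ω := by
  induction w with
  | nil => exact mapsTo_id _
  | cons i w ih => exact (g_mapsTo i).comp ih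

theorem differentiableOn_word (w : List (Fin S.m)) : DifferentiableOn ℂ (S.word w) S.Ω := by
  induction w with
  | nil => exact differentiableOn_id
  | cons i w ih => exact (S.hdiff i).comp ih (word_mapsTo w)

theorem injOn_word (w : List (Fin S.m)) : InjOn (S.word w) S.Ω := by
  induction w with
  | nil => exact injOn_id _
  | cons i w ih => exact (S.hinj i).comp ih (word_mapsTo w)

theorem differentiableAt_word (w : List (Fin S.m)) {z : ℂ} (hz : z ∈ S.Ω) :
    DifferentiableAt ℂ (S.word w) z :=
  (differentiableOn_word w).differentiableAt (S.hopen.mem_nhds hz)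

theorem deriv_word_append (u v : List (Fin S.m)) {z : ℂ} (hz : z ∈ S.Ω) :
    deriv (S.word (u ++ v)) z = deriv (S.word u) (S.word v z) * deriv (S.word v) z := by
  rw [word_append]
  exact deriv_comp z (differentiableAt_word u (word_mapsTo v hz)) (differentiableAt_word v hz)

theorem deriv_word_cons (i : Fin S.m) (w : List (Fin S.m)) {z : ℂ} (hz : z ∈ S.Ω) :
    deriv (S.word (i :: w)) z = deriv (S.g i) (S.word w z) * deriv (S.word w) z :=
  deriv_word_append [i] w hz

theorem deriv_word_nil (z : ℂ) : deriv (S.word []) z = 1 := deriv_id z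

theorem deriv_word_ne_zero (w : List (Fin S.m)) {z : ℂ} (hz : z ∈ S.Ω) :
    deriv (S.word w) z ≠ 0 :=
  deriv_ne_zero_of_injOn S.hopen (differentiableOn_word w) (injOn_word w) hz

theorem IsAttractor.subset (hA : S.IsAttractor A) : A ⊆ S.Ω := hA.2.2.1

theorem IsAttractor.g_mapsTo (hA : S.IsAttractor A) (i : Fin S.m) : MapsTo (S.g i) A A := by
  intro x hx
  rw [hA.2.2.2]
  exact mem_iUnion.2 ⟨i, mem_image_of_mem _ hx⟩

theorem IsAttractor.word_mapsTo (hA : S.IsAttractor A) (w : List (Fin S.m)) :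
    MapsTo (S.word w) A A := by
  induction w with
  | nil => exact mapsTo_id _
  | cons i w ih => exact (hA.g_mapsTo i).comp ih

theorem IsAttractor.exists_preimage (hA : S.IsAttractor A) {x : ℂ} (hx : x ∈ A) :
    ∃ i, ∃ y ∈ A, S.g i y = x := by
  rw [hA.2.2.2] at hx
  obtain ⟨i, y, hy, h⟩ := mem_iUnion.1 hx
  exact ⟨i, y, hy, h⟩

/-- Uniform exponential contraction, by the Earle–Hamilton argument. -/
theorem exists_deriv_word_le (S : HolIFS) {s : ℝ} (hs : 0 < s) :
    ∃ C θ : ℝ, 1 ≤ C ∧ 0 < θ ∧ θ < 1 ∧ ∀ z, ball z s ⊆ S.Ω → ∀ w : List (Fin S.m),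
      ‖deriv (S.word w) z‖ ≤ C * θ ^ w.length := by
  obtain ⟨R₀, hR₀⟩ := S.hbdd.exists_norm_le
  set R := max R₀ (max 1 s) with hRdef
  have hR1 : 1 ≤ R := le_max_of_le_right (le_max_left _ _)
  have hRs : s ≤ R := le_max_of_le_right (le_max_right _ _)
  have hR : ∀ z ∈ S.Ω, ‖z‖ ≤ R := fun z hz => (hR₀ z hz).trans (le_max_left _ _)
  have hcpt : ∀ i, IsCompact (closure (S.g i '' S.Ω)) := fun i =>
    ((S.hbdd.subset (image_subset_iff.2 (g_mapsTo i))).isCompact_closure)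
  choose δ hδ0 hδ using fun i => (hcpt i).exists_cthickening_subset_open S.hopen (S.hcl i)
  obtain ⟨ε, hε0, hε⟩ : ∃ ε > 0, ∀ i, ε * (2 * R) ≤ δ i := by
    have : Nonempty (Fin S.m) := ⟨⟨0, S.hm⟩⟩
    obtain ⟨i₀, hi₀⟩ := Finite.exists_min δ
    refine ⟨δ i₀ / (2 * R), div_pos (hδ0 _) (by linarith), fun i => ?_⟩
    rw [div_mul_cancel₀ _ (by linarith)]
    exact hi₀ i
  have hmem : ∀ i, ∀ z ∈ S.Ω, ∀ z0 ∈ S.Ω, S.g i z + ε * (S.g i z - S.g i z0) ∈ S.Ω := by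
    intro i z hz z0 hz0
    apply hδ i
    refine mem_cthickening_of_dist_le _ (S.g i z) _ _
      (subset_closure (mem_image_of_mem _ hz)) (le_trans ?_ (hε i))
    rw [dist_eq_norm, add_sub_cancel_left, norm_mul]
    have h1 : ‖(ε : ℂ)‖ = ε := by simp [abs_of_pos hε0]
    rw [h1]
    have := norm_sub_le (S.g i z) (S.g i z0)
    have h2 := hR _ (g_mapsTo i hz)
    have h3 := hR _ (g_mapsTo i hz0)
    exact mul_le_mul_of_nonneg_left (by linarith) hε0.le
  have key : ∀ z, ball z s ⊆ S.Ω → ∀ w : List (Fin S.m), ∀ f : ℂ → ℂ, DifferentiableOn ℂ f S.Ω →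
      (∀ y ∈ S.Ω, ‖f y‖ ≤ 1) →
      ‖deriv f (S.word w z) * deriv (S.word w) z‖ * (1 + ε) ^ w.length ≤ 2 / s := by
    intro z hz w
    have hzΩ : z ∈ S.Ω := hz (mem_ball_self hs)
    induction w with
    | nil =>
      intro f hf hf1
      have hsub : closedBall z (s / 2) ⊆ S.Ω :=
        (closedBall_subset_ball (by linarith)).trans hz
      have := Complex.norm_deriv_le_of_forall_mem_sphere_norm_le (half_pos hs)
        ((hf.mono hsub).diffContOnCl_ball subset_rfl)
        (fun y hy => hf1 y (hsub (sphere_subset_closedBall hy)))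
      simp only [deriv_word_nil, mul_one, List.length_nil, pow_zero]
      refine this.trans (le_of_eq ?_)
      field_simp
    | cons i w ih =>
      intro f hf hf1
      have hz0 := word_mapsTo w hzΩ
      set z0 := S.word w z with hz0def
      set F : ℂ → ℂ := fun y => f (S.g i y + ε * (S.g i y - S.g i z0)) with hF
      have hgd : DifferentiableOn ℂ (fun y => S.g i y + ε * (S.g i y - S.g i z0)) S.Ω :=
        (S.hdiff i).add (((S.hdiff i).sub_const _).const_mul _)
      have h1 := ih F (hf.comp hgd (fun y hy => hmem i y hy z0 hz0))
        (fun y hy => hf1 _ (hmem i y hy z0 hz0))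
      have hgi : HasDerivAt (S.g i) (deriv (S.g i) z0) z0 :=
        ((S.hdiff i).differentiableAt (S.hopen.mem_nhds hz0)).hasDerivAt
      have hin : HasDerivAt (fun y => S.g i y + ε * (S.g i y - S.g i z0))
          (deriv (S.g i) z0 + ε * deriv (S.g i) z0) z0 :=
        hgi.add ((hgi.sub_const _).const_mul _)
      have hfd : HasDerivAt f (deriv f (S.g i z0)) (S.g i z0 + ε * (S.g i z0 - S.g i z0)) := by
        rw [sub_self, mul_zero, add_zero]
        exact (hf.differentiableAt (S.hopen.mem_nhds (g_mapsTo i hz0))).hasDerivAt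
      have hFd : deriv F z0 = deriv f (S.g i z0) * (deriv (S.g i) z0 + ε * deriv (S.g i) z0) :=
        (HasDerivAt.comp z0 hfd hin).deriv
      refine le_trans (le_of_eq ?_) h1
      rw [deriv_word_cons i w hzΩ, hFd, List.length_cons, pow_succ]
      have h3 : ‖(1 + ε : ℂ)‖ = 1 + ε := by
        rw [← Complex.ofReal_one, ← Complex.ofReal_add, Complex.norm_real, Real.norm_eq_abs,
          abs_of_pos (by linarith)]
      rw [show deriv f (S.g i z0) * (deriv (S.g i) z0 + ε * deriv (S.g i) z0) *
        deriv (S.word w) z = (1 + ε) * (deriv f (S.g i z0) * (deriv (S.g i) z0 *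
        deriv (S.word w) z)) by ring, norm_mul (1 + ε : ℂ), h3]
      change ‖deriv f (S.g i z0) * _‖ * _ = _
      ring
  refine ⟨2 * R / s, (1 + ε)⁻¹, ?_, by positivity, inv_lt_one_of_one_lt₀ (by linarith), ?_⟩
  · rw [le_div_iff₀ hs]; linarith
  · intro z hz w
    have hRC : (R : ℂ) ≠ 0 := by
      rw [Complex.ofReal_ne_zero]; linarith
    have h1 := key z hz w (fun y => y / R) (differentiableOn_id.div_const _) (by
      intro y hy
      rw [norm_div, Complex.norm_real, Real.norm_eq_abs, abs_of_pos (by linarith)]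
      exact div_le_one_of_le₀ (hR y hy) (by linarith))
    have h2 : deriv (fun y : ℂ => y / R) (S.word w z) = 1 / R := by
      simp
    rw [h2, norm_mul, norm_div, norm_one, Complex.norm_real, Real.norm_eq_abs,
      abs_of_pos (by linarith : 0 < R)] at h1
    rw [inv_pow, ← div_eq_mul_inv, le_div_iff₀ (by positivity), mul_div_assoc]
    have h3 : ‖deriv (S.word w) z‖ * (1 + ε) ^ w.length =
      R * (1 / R * ‖deriv (S.word w) z‖ * (1 + ε) ^ w.length) := by
      field_simp
    rw [h3]
    calc _ ≤ R * (2 / s) := mul_le_mul_of_nonneg_left h1 (by linarith)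
      _ = _ := by ring

/-- Uniform contraction of an IFS, and bounded distortion of its words, on discs of radius `s`
about the points of the attractor. -/
structure BoundedDistortion (S : HolIFS) (A : Set ℂ) (s C θ c B : ℝ) : Prop where
  s_pos : 0 < s
  one_le_C : 1 ≤ C
  θ_pos : 0 < θ
  θ_lt_one : θ < 1
  c_pos : 0 < c
  c_le_one : c ≤ 1
  B_nonneg : 0 ≤ B
  B_mul_s : B * s ≤ 1 / 2
  closedBall_subset : ∀ x ∈ A, closedBall x s ⊆ S.Ω
  deriv_le : ∀ x ∈ A, ∀ z ∈ closedBall x s, ∀ w : List (Fin S.m),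
    ‖deriv (S.word w) z‖ ≤ C * θ ^ w.length
  le_deriv : ∀ x ∈ A, ∀ i, c ≤ ‖deriv (S.g i) x‖
  distortion : ∀ x ∈ A, ∀ z ∈ closedBall x s, ∀ w : List (Fin S.m),
    ‖deriv (S.word w) z - deriv (S.word w) x‖ ≤ B * ‖z - x‖ * ‖deriv (S.word w) x‖

theorem BoundedDistortion.mono {s C θ c B t : ℝ} (h : S.BoundedDistortion A s C θ c B)
    (ht : 0 < t) (hts : t ≤ s) : S.BoundedDistortion A t C θ c B where
  s_pos := ht
  one_le_C := h.one_le_C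
  θ_pos := h.θ_pos
  θ_lt_one := h.θ_lt_one
  c_pos := h.c_pos
  c_le_one := h.c_le_one
  B_nonneg := h.B_nonneg
  B_mul_s := (mul_le_mul_of_nonneg_left hts h.B_nonneg).trans h.B_mul_s
  closedBall_subset x hx := (closedBall_subset_closedBall hts).trans (h.closedBall_subset x hx)
  deriv_le x hx z hz := h.deriv_le x hx z (closedBall_subset_closedBall hts hz)
  le_deriv := h.le_deriv
  distortion x hx z hz := h.distortion x hx z (closedBall_subset_closedBall hts hz)

theorem norm_word_sub_le {s C θ : ℝ} {x z : ℂ} (hsub : closedBall x s ⊆ S.Ω)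
    {w : List (Fin S.m)}
    (hd : ∀ y ∈ closedBall x s, ‖deriv (S.word w) y‖ ≤ C * θ ^ w.length)
    (hz : z ∈ closedBall x s) :
    ‖S.word w z - S.word w x‖ ≤ C * θ ^ w.length * ‖z - x‖ :=
  Convex.norm_image_sub_le_of_norm_deriv_le (fun _ hy => differentiableAt_word w (hsub hy)) hd
    (convex_closedBall x s) (mem_closedBall_self (dist_nonneg.trans hz)) hz

/-- Each map of the IFS has bounded distortion near the attractor. -/
theorem exists_distortion_g (hA : S.IsAttractor A) {s : ℝ} (hs : 0 < s)
    (hsub : cthickening s A ⊆ S.Ω) :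
    ∃ c L : ℝ, 0 < c ∧ c ≤ 1 ∧ 0 < L ∧ (∀ x ∈ A, ∀ i, c ≤ ‖deriv (S.g i) x‖) ∧
      ∀ x ∈ A, ∀ z ∈ closedBall x s, ∀ i,
        ‖deriv (S.g i) z - deriv (S.g i) x‖ ≤ L * ‖z - x‖ * ‖deriv (S.g i) x‖ := by
  have hne : Nonempty (Fin S.m) := ⟨⟨0, S.hm⟩⟩
  have hd1 : ∀ i, DifferentiableOn ℂ (deriv (S.g i)) S.Ω := fun i => (S.hdiff i).deriv S.hopen
  have hd2 : ∀ i, DifferentiableOn ℂ (deriv (deriv (S.g i))) S.Ω := fun i =>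
    (hd1 i).deriv S.hopen
  have hcpt : IsCompact (cthickening s A) := hA.2.1.cthickening
  choose M hM using fun i => hcpt.exists_bound_of_continuousOn ((hd2 i).continuousOn.mono hsub)
  have hmin : ∀ i, ∃ c > 0, ∀ x ∈ A, c ≤ ‖deriv (S.g i) x‖ := by
    intro i
    obtain ⟨x₀, hx₀, hx₀'⟩ := hA.2.1.exists_isMinOn hA.1
      (((hd1 i).continuousOn.mono hA.subset).norm)
    exact ⟨_, norm_pos_iff.2 (deriv_ne_zero_of_injOn S.hopen (S.hdiff i) (S.hinj i)
      (hA.subset hx₀)), fun x hx => hx₀' hx⟩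
  choose c hc0 hc using hmin
  obtain ⟨i₀, hi₀⟩ := Finite.exists_min c
  obtain ⟨i₁, hi₁⟩ := Finite.exists_max M
  have hc' : ∀ x ∈ A, ∀ i, min (c i₀) 1 ≤ ‖deriv (S.g i) x‖ := fun x hx i =>
    (min_le_left _ _).trans ((hi₀ i).trans (hc i x hx))
  have hcpos : 0 < min (c i₀) 1 := lt_min (hc0 _) one_pos
  refine ⟨min (c i₀) 1, (|M i₁| + 1) / min (c i₀) 1, hcpos, min_le_right _ _, by positivity,
    hc', ?_⟩
  intro x hx z hz i
  have hball : closedBall x s ⊆ cthickening s A := closedBall_subset_cthickening hx s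
  have h1 : ‖deriv (S.g i) z - deriv (S.g i) x‖ ≤ (|M i₁| + 1) * ‖z - x‖ :=
    Convex.norm_image_sub_le_of_norm_deriv_le
      (fun y hy => (hd1 i).differentiableAt (S.hopen.mem_nhds (hsub (hball hy))))
      (fun y hy => (hM i y (hball hy)).trans (by linarith [hi₁ i, le_abs_self (M i₁)]))
      (convex_closedBall x s) (mem_closedBall_self hs.le) hz
  refine h1.trans ?_
  rw [div_mul_eq_mul_div, div_mul_eq_mul_div, le_div_iff₀ hcpos]
  exact mul_le_mul_of_nonneg_left (hc' x hx i) (by positivity)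

theorem exists_boundedDistortion (hA : S.IsAttractor A) :
    ∃ s C θ c B : ℝ, S.BoundedDistortion A s C θ c B := by
  obtain ⟨s₂, hs₂, hsub₂⟩ := hA.2.1.exists_cthickening_subset_open S.hopen hA.subset
  set s₁ := s₂ / 2 with hs₁def
  have hs₁ : 0 < s₁ := half_pos hs₂
  obtain ⟨C, θ, hC, hθ, hθ1, hcon⟩ := S.exists_deriv_word_le hs₁
  have hcon' : ∀ x ∈ A, ∀ z ∈ closedBall x s₁, ∀ w : List (Fin S.m),
      ‖deriv (S.word w) z‖ ≤ C * θ ^ w.length := by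
    intro x hx z hz w
    refine hcon z ?_ w
    intro y hy
    apply hsub₂
    apply closedBall_subset_cthickening hx
    rw [mem_closedBall] at hz ⊢
    rw [mem_ball] at hy
    linarith [dist_triangle y z x]
  have hsub₁ : cthickening s₁ A ⊆ S.Ω := (cthickening_mono (by linarith) A).trans hsub₂
  have hball : ∀ x ∈ A, closedBall x s₁ ⊆ S.Ω := fun x hx =>
    (closedBall_subset_cthickening hx _).trans hsub₁
  obtain ⟨c, L, hc, hc1, hL, hlow, hdist⟩ := exists_distortion_g hA hs₁ hsub₁
  have h1θ : 0 < 1 - θ := by linarith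
  have hCpos : 0 < C := by linarith
  set B := 2 * (L * C / (1 - θ)) with hB
  have hBpos : 0 < B := by positivity
  obtain ⟨s, hs, hss₁, hCs, hBs⟩ : ∃ s > 0, s ≤ s₁ ∧ C * s ≤ s₁ ∧ B * s ≤ 1 / 2 := by
    refine ⟨min s₁ (min (s₁ / C) (1 / 2 / B)), ?_, min_le_left _ _, ?_, ?_⟩
    · refine lt_min hs₁ (lt_min ?_ ?_) <;> positivity
    · rw [← le_div_iff₀' hCpos]
      exact (min_le_right _ _).trans (min_le_left _ _)
    · rw [← le_div_iff₀' hBpos]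
      exact (min_le_right _ _).trans (min_le_right _ _)
  have hcb : ∀ x : ℂ, closedBall x s ⊆ closedBall x s₁ := fun x => closedBall_subset_closedBall hss₁
  refine ⟨s, C, θ, c, B, hs, hC, hθ, hθ1, hc, hc1, hBpos.le, hBs,
    fun x hx => (hcb x).trans (hball x hx), fun x hx z hz => hcon' x hx z (hcb x hz), hlow, ?_⟩
  intro x hx z hz w
  have hzs : ‖z - x‖ ≤ s := mem_closedBall_iff_norm.1 hz
  have key : ‖deriv (S.word w) z - deriv (S.word w) x‖ ≤
      (Real.exp (L * C * ‖z - x‖ * ∑ j ∈ Finset.range w.length, θ ^ j) - 1) *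
        ‖deriv (S.word w) x‖ := by
    induction w with
    | nil => simp [deriv_word_nil]
    | cons i w ih =>
      have hzΩ := hball x hx (hcb x hz)
      have hxΩ := hA.subset hx
      rw [deriv_word_cons i w hzΩ, deriv_word_cons i w hxΩ, List.length_cons,
        Finset.sum_range_succ, mul_add, Real.exp_add]
      set t := ‖z - x‖ with ht
      have ht0 : 0 ≤ t := norm_nonneg _
      have h1 : ‖S.word w z - S.word w x‖ ≤ C * θ ^ w.length * t :=
        norm_word_sub_le (hball x hx) (fun y hy => hcon' x hx y hy w) (hcb x hz)
      have hθn : θ ^ w.length ≤ 1 := pow_le_one₀ hθ.le hθ1.le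
      have h2 : S.word w z ∈ closedBall (S.word w x) s₁ := by
        rw [mem_closedBall_iff_norm]
        refine h1.trans (le_trans ?_ hCs)
        have h3 : θ ^ w.length * t ≤ 1 * s := mul_le_mul hθn hzs ht0 zero_le_one
        rw [mul_assoc]
        exact (mul_le_mul_of_nonneg_left h3 hCpos.le).trans (by rw [one_mul])
      have h3 := hdist _ (hA.word_mapsTo w hx) _ h2 i
      set a := Real.exp (L * C * t * ∑ j ∈ Finset.range w.length, θ ^ j) with ha
      set b := L * C * t * θ ^ w.length with hb
      set dx := deriv (S.word w) x
      set dz := deriv (S.word w) z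
      set gx := deriv (S.g i) (S.word w x)
      set gz := deriv (S.g i) (S.word w z)
      have hb0 : 0 ≤ b := by positivity
      have h4 : ‖gz - gx‖ ≤ b * ‖gx‖ := by
        refine h3.trans (mul_le_mul_of_nonneg_right ?_ (norm_nonneg _))
        exact (mul_le_mul_of_nonneg_left h1 hL.le).trans (le_of_eq (by rw [hb]; ring))
      have h5 : b + 1 ≤ Real.exp b := Real.add_one_le_exp b
      have hdz : ‖dz‖ ≤ a * ‖dx‖ := by
        have := norm_add_le (dz - dx) dx
        rw [sub_add_cancel] at this
        linarith
      have ha0 : 0 < a := Real.exp_pos _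
      calc ‖gz * dz - gx * dx‖ = ‖(gz - gx) * dz + gx * (dz - dx)‖ := by ring_nf
        _ ≤ ‖gz - gx‖ * ‖dz‖ + ‖gx‖ * ‖dz - dx‖ := by
          rw [← norm_mul, ← norm_mul]; exact norm_add_le _ _
        _ ≤ (b * ‖gx‖) * (a * ‖dx‖) + ‖gx‖ * ((a - 1) * ‖dx‖) := by gcongr
        _ = (a * (b + 1) - 1) * (‖gx‖ * ‖dx‖) := by ring
        _ ≤ (a * Real.exp b - 1) * (‖gx‖ * ‖dx‖) := by gcongr
        _ = (a * Real.exp b - 1) * ‖gx * dx‖ := by rw [norm_mul]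
  refine key.trans (mul_le_mul_of_nonneg_right ?_ (norm_nonneg _))
  set t := ‖z - x‖ with ht
  have ht0 : 0 ≤ t := norm_nonneg _
  have hsum : ∑ j ∈ Finset.range w.length, θ ^ j ≤ 1 / (1 - θ) := by
    rw [geom_sum_eq hθ1.ne, ← neg_div_neg_eq, neg_sub, neg_sub]
    have : 0 ≤ θ ^ w.length := by positivity
    gcongr
    linarith
  have hle : L * C * t * ∑ j ∈ Finset.range w.length, θ ^ j ≤ B / 2 * t := by
    calc _ ≤ L * C * t * (1 / (1 - θ)) := mul_le_mul_of_nonneg_left hsum (by positivity)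
      _ = _ := by rw [hB]; ring
  have hBt : B / 2 * t ≤ 1 := by
    have := mul_le_mul_of_nonneg_left hzs hBpos.le
    linarith
  have h0 : 0 ≤ B / 2 * t := by positivity
  have h7 := Real.abs_exp_sub_one_le (x := B / 2 * t) (by rwa [abs_of_nonneg h0])
  rw [abs_of_nonneg h0] at h7
  have h8 := Real.exp_le_exp.2 hle
  linarith [le_abs_self (Real.exp (B / 2 * t) - 1)]

theorem BoundedDistortion.pow_le_deriv {s C θ c B : ℝ} (h : S.BoundedDistortion A s C θ c B)
    (hA : S.IsAttractor A) (w : List (Fin S.m)) {x : ℂ} (hx : x ∈ A) :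
    c ^ w.length ≤ ‖deriv (S.word w) x‖ := by
  induction w with
  | nil => simp [deriv_word_nil]
  | cons i w ih =>
    rw [deriv_word_cons i w (hA.subset hx), norm_mul, List.length_cons, pow_succ']
    exact mul_le_mul (h.le_deriv _ (hA.word_mapsTo w hx) i) ih (pow_nonneg h.c_pos.le _)
      (norm_nonneg _)

theorem BoundedDistortion.norm_word_sub_le {s C θ c B : ℝ}
    (h : S.BoundedDistortion A s C θ c B) {x z : ℂ} (hx : x ∈ A) (hz : z ∈ closedBall x s)
    (w : List (Fin S.m)) :
    ‖S.word w z - S.word w x‖ ≤ C * θ ^ w.length * ‖z - x‖ :=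
  HolIFS.norm_word_sub_le (h.closedBall_subset x hx) (fun y hy => h.deriv_le x hx y hy w) hz

theorem BoundedDistortion.exists_pow_le {s C θ c B : ℝ}
    (h : S.BoundedDistortion A s C θ c B) {ε : ℝ} (hε : 0 < ε) :
    ∃ k : ℕ, ∀ n, k ≤ n → C * θ ^ n ≤ ε := by
  have hC := h.one_le_C
  obtain ⟨k, hk⟩ := exists_pow_lt_of_lt_one (div_pos hε (by linarith : 0 < C)) h.θ_lt_one
  refine ⟨k, fun n hn => ?_⟩
  rw [← le_div_iff₀' (by linarith)]
  exact (pow_le_pow_of_le_one h.θ_pos.le h.θ_lt_one.le hn).trans hk.le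

/-- Long words contract the whole attractor uniformly. -/
theorem exists_norm_word_sub_le (hA : S.IsAttractor A) {ε : ℝ} (hε : 0 < ε) :
    ∃ k : ℕ, ∀ w : List (Fin S.m), k ≤ w.length → ∀ x ∈ A, ∀ y ∈ A,
      ‖S.word w x - S.word w y‖ ≤ ε := by
  have hloc : ∀ x ∈ S.Ω, ∃ r > 0, ∀ η > (0 : ℝ), ∃ k : ℕ, ∀ w : List (Fin S.m), k ≤ w.length →
      ∀ y ∈ ball x r, ‖S.word w x - S.word w y‖ ≤ η := by
    intro x hx
    obtain ⟨s, hs, hsub⟩ := Metric.isOpen_iff.1 S.hopen x hx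
    obtain ⟨C, θ, hC, hθ, hθ1, hcon⟩ := S.exists_deriv_word_le (half_pos hs)
    have hCpos : 0 < C := by linarith
    refine ⟨s / 4, by linarith, fun η hη => ?_⟩
    obtain ⟨k, hk⟩ := exists_pow_lt_of_lt_one
      (show 0 < η / (C * s) from div_pos hη (mul_pos hCpos hs)) hθ1
    refine ⟨k, fun w hw y hy => ?_⟩
    rw [norm_sub_rev]
    have h1 := HolIFS.norm_word_sub_le (x := x) (s := s / 4) (z := y) (w := w) (C := C) (θ := θ)
      ((closedBall_subset_ball (by linarith)).trans hsub) (fun z hz => hcon z (by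
        intro u hu
        apply hsub
        rw [mem_closedBall] at hz
        rw [mem_ball] at hu ⊢
        linarith [dist_triangle u z x]) w) (ball_subset_closedBall hy)
    have h2 : ‖y - x‖ ≤ s := by
      rw [mem_ball_iff_norm] at hy; linarith
    have h3 : θ ^ w.length ≤ η / (C * s) :=
      (pow_le_pow_of_le_one hθ.le hθ1.le hw).trans hk.le
    calc _ ≤ _ := h1
      _ ≤ C * (η / (C * s)) * s := by gcongr
      _ = η := by field_simp
  have hpair : ∀ x ∈ S.Ω, ∀ y ∈ S.Ω, ∀ η > (0 : ℝ), ∃ k : ℕ, ∀ w : List (Fin S.m),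
      k ≤ w.length → ‖S.word w x - S.word w y‖ ≤ η := by
    intro x hx y hy
    refine S.hconn.isPreconnected.induction₂ (fun x y => ∀ η > (0 : ℝ), ∃ k : ℕ,
      ∀ w : List (Fin S.m), k ≤ w.length → ‖S.word w x - S.word w y‖ ≤ η) ?_ ?_ ?_ hx hy
    · intro x hx
      obtain ⟨r, hr, hloc'⟩ := hloc x hx
      refine nhdsWithin_le_nhds ?_
      filter_upwards [ball_mem_nhds x hr] with y hy η hη
      obtain ⟨k, hk⟩ := hloc' η hη
      exact ⟨k, fun w hw => hk w hw y hy⟩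
    · intro x y z _ _ _ hxy hyz η hη
      obtain ⟨k₁, h₁⟩ := hxy (η / 2) (half_pos hη)
      obtain ⟨k₂, h₂⟩ := hyz (η / 2) (half_pos hη)
      refine ⟨max k₁ k₂, fun w hw => ?_⟩
      have := norm_sub_le_norm_sub_add_norm_sub (S.word w x) (S.word w y) (S.word w z)
      linarith [h₁ w ((le_max_left _ _).trans hw), h₂ w ((le_max_right _ _).trans hw)]
    · intro x y _ _ hxy η hη
      obtain ⟨k, hk⟩ := hxy η hη
      exact ⟨k, fun w hw => by rw [norm_sub_rev]; exact hk w hw⟩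
  obtain ⟨x₀, hx₀⟩ := hA.1
  have hunif : ∃ k : ℕ, ∀ w : List (Fin S.m), k ≤ w.length → ∀ y ∈ A,
      ‖S.word w x₀ - S.word w y‖ ≤ ε / 2 := by
    refine hA.2.1.induction_on (p := fun t => ∃ k : ℕ, ∀ w : List (Fin S.m), k ≤ w.length →
      ∀ y ∈ t, ‖S.word w x₀ - S.word w y‖ ≤ ε / 2) ⟨0, by simp⟩ ?_ ?_ ?_
    · rintro t u htu ⟨k, hk⟩
      exact ⟨k, fun w hw y hy => hk w hw y (htu hy)⟩
    · rintro t u ⟨k₁, h₁⟩ ⟨k₂, h₂⟩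
      refine ⟨max k₁ k₂, fun w hw y hy => ?_⟩
      rcases hy with hy | hy
      · exact h₁ w ((le_max_left _ _).trans hw) y hy
      · exact h₂ w ((le_max_right _ _).trans hw) y hy
    · intro x hx
      obtain ⟨r, hr, hloc'⟩ := hloc x (hA.subset hx)
      obtain ⟨k₁, h₁⟩ := hloc' (ε / 4) (by linarith)
      obtain ⟨k₂, h₂⟩ := hpair x₀ (hA.subset hx₀) x (hA.subset hx) (ε / 4) (by linarith)
      refine ⟨ball x r, nhdsWithin_le_nhds (ball_mem_nhds x hr), max k₁ k₂, fun w hw y hy => ?_⟩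
      have := norm_sub_le_norm_sub_add_norm_sub (S.word w x₀) (S.word w x) (S.word w y)
      linarith [h₁ w ((le_max_left _ _).trans hw) y hy, h₂ w ((le_max_right _ _).trans hw)]
  obtain ⟨k, hk⟩ := hunif
  refine ⟨k, fun w hw x hx y hy => ?_⟩
  have := norm_sub_le_norm_sub_add_norm_sub (S.word w x) (S.word w x₀) (S.word w y)
  have h1 := hk w hw x hx
  rw [norm_sub_rev] at h1
  linarith [hk w hw y hy]

theorem BoundedDistortion.norm_deriv_sub_le_half {s C θ c B : ℝ}
    (h : S.BoundedDistortion A s C θ c B) {x z : ℂ} (hx : x ∈ A) (hz : z ∈ closedBall x s)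
    (w : List (Fin S.m)) :
    ‖deriv (S.word w) z - deriv (S.word w) x‖ ≤ 1 / 2 * ‖deriv (S.word w) x‖ := by
  refine (h.distortion x hx z hz w).trans (mul_le_mul_of_nonneg_right ?_ (norm_nonneg _))
  exact (mul_le_mul_of_nonneg_left (mem_closedBall_iff_norm.1 hz) h.B_nonneg).trans h.B_mul_s

theorem BoundedDistortion.norm_deriv_le {s C θ c B : ℝ}
    (h : S.BoundedDistortion A s C θ c B) {x z : ℂ} (hx : x ∈ A) (hz : z ∈ closedBall x s)
    (w : List (Fin S.m)) :
    ‖deriv (S.word w) z‖ ≤ 3 / 2 * ‖deriv (S.word w) x‖ := by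
  have h1 := h.norm_deriv_sub_le_half hx hz w
  have h2 := norm_sub_norm_le (deriv (S.word w) z) (deriv (S.word w) x)
  linarith

theorem BoundedDistortion.half_le_norm_deriv {s C θ c B : ℝ}
    (h : S.BoundedDistortion A s C θ c B) {x z : ℂ} (hx : x ∈ A) (hz : z ∈ closedBall x s)
    (w : List (Fin S.m)) :
    1 / 2 * ‖deriv (S.word w) x‖ ≤ ‖deriv (S.word w) z‖ := by
  have h1 := h.norm_deriv_sub_le_half hx hz w
  have h2 := norm_sub_norm_le (deriv (S.word w) x) (deriv (S.word w) z)
  rw [norm_sub_rev] at h2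
  linarith

theorem BoundedDistortion.norm_deriv_word_le {s C θ c B : ℝ}
    (h : S.BoundedDistortion A s C θ c B) {x : ℂ} (hx : x ∈ A) (w : List (Fin S.m)) :
    ‖deriv (S.word w) x‖ ≤ C := by
  refine (h.deriv_le x hx x (mem_closedBall_self h.s_pos.le) w).trans ?_
  have : 0 ≤ C := by linarith [h.one_le_C]
  exact mul_le_of_le_one_right this (pow_le_one₀ h.θ_pos.le h.θ_lt_one.le)

/-- The derivatives of a word at any two points of the attractor are comparable, and comparable
to the diameter of the corresponding cylinder. -/
theorem BoundedDistortion.exists_comparable {s C θ c B : ℝ}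
    (h : S.BoundedDistortion A s C θ c B) (hA : S.IsAttractor A) :
    ∃ H : ℝ, 1 ≤ H ∧ ∀ w : List (Fin S.m), ∀ x ∈ A, ∀ y ∈ A,
      ‖deriv (S.word w) x‖ ≤ H * ‖deriv (S.word w) y‖ ∧
      ‖S.word w x - S.word w y‖ ≤ H * ‖deriv (S.word w) y‖ := by
  obtain ⟨k, hk⟩ := exists_norm_word_sub_le hA h.s_pos
  obtain ⟨R, hR⟩ := hA.2.1.isBounded.exists_norm_le
  have hR0 : 0 ≤ R := (norm_nonneg _).trans (hR _ hA.1.some_mem)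
  have hs := h.s_pos
  have hC := h.one_le_C
  have hck : 0 < c ^ k := pow_pos h.c_pos k
  have hck1 : c ^ k ≤ 1 := pow_le_one₀ h.c_pos.le h.c_le_one
  set M := 3 / 2 * C + 2 * R + 3 / 2 * s with hM
  refine ⟨M / c ^ k, ?_, fun w x hx y hy => ?_⟩
  · rw [le_div_iff₀ hck]; linarith
  rw [div_mul_eq_mul_div, le_div_iff₀ hck, le_div_iff₀ hck]
  by_cases hw : k ≤ w.length
  · obtain ⟨α, β, rfl, hβ⟩ : ∃ α β, w = α ++ β ∧ β.length = k :=
      ⟨w.take (w.length - k), w.drop (w.length - k), (List.take_append_drop _ _).symm, by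
        rw [List.length_drop]; omega⟩
    have hxA := hA.word_mapsTo β hx
    have hyA := hA.word_mapsTo β hy
    have hnear : S.word β x ∈ closedBall (S.word β y) s :=
      mem_closedBall_iff_norm.2 (hk β hβ.ge x hx y hy)
    have hβy : c ^ k ≤ ‖deriv (S.word β) y‖ := hβ ▸ h.pow_le_deriv hA β hy
    rw [deriv_word_append _ _ (hA.subset hx), deriv_word_append _ _ (hA.subset hy), norm_mul,
      norm_mul, word_append]
    have h1 := h.norm_deriv_le hyA hnear α
    have h2 := h.norm_deriv_word_le hx β
    set dα := ‖deriv (S.word α) (S.word β y)‖ with hdα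
    have hdα0 : 0 ≤ dα := norm_nonneg _
    constructor
    · calc _ ≤ (3 / 2 * dα * C) * ‖deriv (S.word β) y‖ := by gcongr
        _ = (3 / 2 * C) * (dα * ‖deriv (S.word β) y‖) := by ring
        _ ≤ _ := mul_le_mul_of_nonneg_right (by linarith) (by positivity)
    · have h3 : ‖S.word α (S.word β x) - S.word α (S.word β y)‖ ≤
          3 / 2 * dα * ‖S.word β x - S.word β y‖ :=
        Convex.norm_image_sub_le_of_norm_deriv_le
          (fun z hz => differentiableAt_word α (h.closedBall_subset _ hyA hz))
          (fun z hz => h.norm_deriv_le hyA hz α) (convex_closedBall _ _)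
          (mem_closedBall_self hs.le) hnear
      calc _ ≤ (3 / 2 * dα * s) * ‖deriv (S.word β) y‖ := by
            have h4 : ‖S.word β x - S.word β y‖ ≤ s := hk β hβ.ge x hx y hy
            gcongr
            exact h3.trans (by gcongr)
        _ = (3 / 2 * s) * (dα * ‖deriv (S.word β) y‖) := by ring
        _ ≤ _ := mul_le_mul_of_nonneg_right (by linarith) (by positivity)
  · have hwy : c ^ k ≤ ‖deriv (S.word w) y‖ :=
      (pow_le_pow_of_le_one h.c_pos.le h.c_le_one (not_le.1 hw).le).trans
        (h.pow_le_deriv hA w hy)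
    have h0 : (0 : ℝ) ≤ c ^ k := hck.le
    constructor
    · refine mul_le_mul ((h.norm_deriv_word_le hx w).trans ?_) hwy h0 (by positivity)
      linarith
    · refine mul_le_mul ((norm_sub_le _ _).trans ?_) hwy h0 (by positivity)
      linarith [hR _ (hA.word_mapsTo w hx), hR _ (hA.word_mapsTo w hy)]

/-- Points far apart stay apart relative to the derivative of the word. -/
theorem BoundedDistortion.le_norm_word_sub {s C θ c B : ℝ}
    (h : S.BoundedDistortion A s C θ c B) (hA : S.IsAttractor A) {x y : ℂ} (hx : x ∈ A)
    (hy : y ∈ S.Ω) (hxy : s < ‖x - y‖) (w : List (Fin S.m)) :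
    s / 4 * ‖deriv (S.word w) x‖ ≤ ‖S.word w x - S.word w y‖ := by
  have hs := h.s_pos
  have hsub := h.closedBall_subset x hx
  set p := deriv (S.word w) x with hp
  have hp0 : 0 < ‖p‖ := norm_pos_iff.2 (deriv_word_ne_zero w (hA.subset hx))
  have hsphere : ∀ z ∈ sphere x s, s * ‖p‖ / 2 ≤ ‖S.word w z - S.word w x‖ := by
    intro z hz
    have hdiff : ∀ u ∈ closedBall x s,
        HasDerivAt (fun u => S.word w u - p * u) (deriv (S.word w) u - p) u := by
      intro u hu
      have h1 : HasDerivAt (fun u => p * u) p u := by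
        simpa using (hasDerivAt_id u).const_mul p
      exact (differentiableAt_word w (hsub hu)).hasDerivAt.sub h1
    have h1 := Convex.norm_image_sub_le_of_norm_hasDerivWithin_le
      (fun u hu => (hdiff u hu).hasDerivWithinAt)
      (fun u hu => h.norm_deriv_sub_le_half hx hu w) (convex_closedBall x s)
      (mem_closedBall_self hs.le) (sphere_subset_closedBall hz)
    have hzx : ‖z - x‖ = s := by rwa [← dist_eq_norm]
    have h2 : ‖p * (z - x)‖ = ‖p‖ * s := by rw [norm_mul, hzx]
    have h3 := norm_sub_norm_le (p * (z - x)) (S.word w z - S.word w x)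
    rw [norm_sub_rev (p * (z - x)), show S.word w z - S.word w x - p * (z - x) =
      S.word w z - p * z - (S.word w x - p * x) by ring] at h3
    rw [hzx] at h1
    linarith
  have hfreq : ∃ᶠ z in nhds x, S.word w z ≠ S.word w x := by
    have h1 : ∀ᶠ z in nhdsWithin x {x}ᶜ, S.word w z ≠ S.word w x := by
      filter_upwards [self_mem_nhdsWithin,
        nhdsWithin_le_nhds (S.hopen.mem_nhds (hA.subset hx))] with z hz hzΩ heq
      exact hz (injOn_word w hzΩ (hA.subset hx) heq)
    exact h1.frequently.filter_mono nhdsWithin_le_nhds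
  have himg := DiffContOnCl.ball_subset_image_closedBall
    (((differentiableOn_word w).mono hsub).diffContOnCl_ball subset_rfl) hs hsphere hfreq
  by_contra hlt
  obtain ⟨z, hz, hzy⟩ := himg (show S.word w y ∈ ball (S.word w x) (s * ‖p‖ / 2 / 2) by
    rw [mem_ball_iff_norm, norm_sub_rev]
    linarith [not_le.1 hlt])
  have := injOn_word w (hsub hz) hy hzy
  subst this
  rw [mem_closedBall_iff_norm, norm_sub_rev] at hz
  linarith

theorem exists_separation (hA : S.IsAttractor A) (hSSC : S.SSC A) :
    ∃ d > (0 : ℝ), ∀ i j, i ≠ j → ∀ x ∈ S.g i '' A, ∀ y ∈ S.g j '' A, d < ‖x - y‖ := by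
  have hne : Nonempty (Fin S.m) := ⟨⟨0, S.hm⟩⟩
  have hcpt : ∀ i, IsCompact (S.g i '' A) := fun i =>
    hA.2.1.image_of_continuousOn ((S.hdiff i).continuousOn.mono hA.subset)
  have hpair : ∀ q : Fin S.m × Fin S.m, ∃ d > (0 : ℝ), q.1 ≠ q.2 →
      ∀ x ∈ S.g q.1 '' A, ∀ y ∈ S.g q.2 '' A, d < ‖x - y‖ := by
    intro q
    by_cases hq : q.1 = q.2
    · exact ⟨1, one_pos, fun h => absurd hq h⟩
    · obtain ⟨r, hr, hr'⟩ := Metric.exists_pos_forall_lt_edist (hcpt q.1) (hcpt q.2).isClosed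
        (hSSC _ _ hq)
      refine ⟨r, hr, fun _ x hx y hy => ?_⟩
      have := hr' x hx y hy
      rw [edist_nndist, ENNReal.coe_lt_coe] at this
      rw [← dist_eq_norm, ← coe_nndist]
      exact_mod_cast this
  choose d hd0 hd using hpair
  obtain ⟨q, hq⟩ := Finite.exists_min d
  exact ⟨d q, hd0 q, fun i j hij x hx y hy => (hq (i, j)).trans_lt (hd (i, j) hij x hx y hy)⟩

/-- Cylinders are separated from the rest of the attractor by a gap comparable to their size. -/
theorem BoundedDistortion.exists_gap {s C θ c B : ℝ}
    (h : S.BoundedDistortion A s C θ c B) (hA : S.IsAttractor A) (hSSC : S.SSC A) :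
    ∃ κ > (0 : ℝ), ∀ w : List (Fin S.m), ∀ x ∈ A, ∀ y ∈ A, y ∉ S.word w '' A →
      κ * ‖deriv (S.word w) x‖ ≤ ‖S.word w x - y‖ := by
  obtain ⟨d, hd0, hd⟩ := exists_separation hA hSSC
  set t := min s d with ht
  have ht0 : 0 < t := lt_min h.s_pos hd0
  have h' := h.mono ht0 (min_le_left _ _)
  have hCpos : 0 < C := by linarith [h.one_le_C]
  refine ⟨t / 4 / C, by positivity, ?_⟩
  have key : ∀ w α : List (Fin S.m), ∀ x ∈ A, ∀ y ∈ A, y ∉ S.word w '' A →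
      t / 4 / C * ‖deriv (S.word (α ++ w)) x‖ ≤ ‖S.word α (S.word w x) - S.word α y‖ := by
    intro w
    induction w with
    | nil =>
      intro α x _ y hy hyw
      exact absurd ⟨y, hy, rfl⟩ hyw
    | cons i w ih =>
      intro α x hx y hy hyw
      obtain ⟨j, y', hy', rfl⟩ := hA.exists_preimage hy
      by_cases hij : i = j
      · subst hij
        have hy'w : y' ∉ S.word w '' A := by
          rintro ⟨z, hz, rfl⟩
          exact hyw ⟨z, hz, rfl⟩
        have := ih (α ++ [i]) x hx y' hy' hy'w
        rw [List.append_assoc, word_append α [i]] at this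
        exact this
      · have hw := hA.word_mapsTo (i :: w) hx
        have hfar : t < ‖S.word (i :: w) x - S.g j y'‖ :=
          (min_le_right _ _).trans_lt (hd i j hij _ ⟨_, hA.word_mapsTo w hx, rfl⟩ _
            ⟨y', hy', rfl⟩)
        have h1 := h'.le_norm_word_sub hA hw (hA.subset hy) hfar α
        refine le_trans ?_ h1
        rw [deriv_word_append _ _ (hA.subset hx), norm_mul, div_mul_eq_mul_div,
          div_le_iff₀ hCpos, ← mul_assoc]
        exact mul_le_mul_of_nonneg_left (h.norm_deriv_word_le hx _) (by positivity)
  intro w x hx y hy hyw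
  exact key w [] x hx y hy hyw

/-- A coding of the point `x` of the attractor: `w n` is its word of length `n`, and `t n` the
point of the attractor with `word (w n) (t n) = x`. -/
structure IsCoding (S : HolIFS) (A : Set ℂ) (x : ℂ) (t : ℕ → ℂ) (w : ℕ → List (Fin S.m)) :
    Prop where
  t_zero : t 0 = x
  w_zero : w 0 = []
  mem : ∀ n, t n ∈ A
  step : ∀ n, ∃ i, w (n + 1) = w n ++ [i] ∧ S.g i (t (n + 1)) = t n

theorem IsAttractor.exists_isCoding (hA : S.IsAttractor A) {x : ℂ} (hx : x ∈ A) :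
    ∃ t w, S.IsCoding A x t w := by
  have hne : Nonempty (Fin S.m) := ⟨⟨0, S.hm⟩⟩
  choose! ι T hTA hT using fun (y : ℂ) (hy : y ∈ A) => hA.exists_preimage hy
  have hmem : ∀ n, T^[n] x ∈ A := fun n => (show MapsTo T A A from hTA).iterate n hx
  refine ⟨fun n => T^[n] x, fun n => (List.range n).map fun k => ι (T^[k] x), rfl, rfl, hmem,
    fun n => ⟨ι (T^[n] x), by simp [List.range_succ], ?_⟩⟩
  rw [Function.iterate_succ_apply']
  exact hT _ (hmem n)

namespace IsCoding

variable {x : ℂ} {t : ℕ → ℂ} {w : ℕ → List (Fin S.m)}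

theorem length (h : S.IsCoding A x t w) (n : ℕ) : (w n).length = n := by
  induction n with
  | zero => simp [h.w_zero]
  | succ n ih =>
    obtain ⟨i, hi, _⟩ := h.step n
    simp [hi, ih]

theorem exists_append (h : S.IsCoding A x t w) {n k : ℕ} (hnk : n ≤ k) :
    ∃ u, w k = w n ++ u ∧ S.word u (t k) = t n := by
  induction k, hnk using Nat.le_induction with
  | base => exact ⟨[], by simp, rfl⟩
  | succ k _ ih =>
    obtain ⟨u, hu, hut⟩ := ih
    obtain ⟨i, hi, hit⟩ := h.step k
    refine ⟨u ++ [i], by rw [hi, hu, List.append_assoc], ?_⟩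
    rw [word_append]
    change S.word u (S.g i (t (k + 1))) = t n
    rw [hit, hut]

theorem word_eq (h : S.IsCoding A x t w) (n : ℕ) : S.word (w n) (t n) = x := by
  obtain ⟨u, hu, hut⟩ := h.exists_append (Nat.zero_le n)
  rw [hu, h.w_zero, List.nil_append, hut, h.t_zero]

theorem mul_deriv_le {s C θ c B : ℝ} (h : S.IsCoding A x t w) (hA : S.IsAttractor A)
    (hB : S.BoundedDistortion A s C θ c B) (n : ℕ) :
    c * ‖deriv (S.word (w n)) (t n)‖ ≤ ‖deriv (S.word (w (n + 1))) (t (n + 1))‖ := by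
  obtain ⟨i, hi, hit⟩ := h.step n
  rw [hi, deriv_word_append _ _ (hA.subset (h.mem _)), norm_mul]
  change _ ≤ ‖deriv (S.word (w n)) (S.g i (t (n + 1)))‖ * ‖deriv (S.g i) (t (n + 1))‖
  rw [hit, mul_comm]
  exact mul_le_mul_of_nonneg_left (hB.le_deriv _ (h.mem _) i) (norm_nonneg _)

theorem exists_deriv_le {s C θ c B : ℝ} (h : S.IsCoding A x t w)
    (hB : S.BoundedDistortion A s C θ c B) {ε : ℝ} (hε : 0 < ε) :
    ∃ k, ∀ n, k ≤ n → ‖deriv (S.word (w n)) (t n)‖ ≤ ε := by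
  obtain ⟨k, hk⟩ := hB.exists_pow_le hε
  refine ⟨k, fun n hn => (hB.deriv_le _ (h.mem n) _ (mem_closedBall_self hB.s_pos.le) _).trans ?_⟩
  rw [h.length]
  exact hk n hn

end IsCoding

/-- The attractor has no isolated points. -/
theorem IsAttractor.frequently_mem (hA : S.IsAttractor A) (hA2 : A.Nontrivial) {x : ℂ}
    (hx : x ∈ A) : ∃ᶠ z in nhdsWithin x {x}ᶜ, z ∈ A := by
  refine accPt_iff_frequently_nhdsNE.1 (accPt_iff_nhds.2 ?_)
  intro U hU
  obtain ⟨ε, hε, hεU⟩ := Metric.mem_nhds_iff.1 hU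
  obtain ⟨k, hk⟩ := exists_norm_word_sub_le hA (half_pos hε)
  obtain ⟨t, w, hc⟩ := hA.exists_isCoding hx
  obtain ⟨q, hq, hqt⟩ := hA2.exists_ne (t k)
  refine ⟨S.word (w k) q, ⟨hεU ?_, hA.word_mapsTo _ hq⟩, ?_⟩
  · have := hk (w k) (hc.length k).ge q hq (t k) (hc.mem k)
    rw [hc.word_eq] at this
    rw [mem_ball_iff_norm]
    linarith
  · intro heq
    rw [← hc.word_eq k] at heq
    exact hqt (injOn_word _ (hA.subset hq) (hA.subset (hc.mem k)) heq)

/-- A holomorphic map sending the attractor into itself that is sufficiently `C¹`-close to a word,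
relative to the derivative of the word, coincides with that word. -/
theorem BoundedDistortion.exists_eqOn_word {s C θ c B : ℝ}
    (h : S.BoundedDistortion A s C θ c B) (hs1 : s ≤ 1) (hA : S.IsAttractor A)
    (hA2 : A.Nontrivial) (hSSC : S.SSC A) :
    ∃ η > (0 : ℝ), ∀ w : List (Fin S.m), ∀ b ∈ A, ∀ ρ > (0 : ℝ), ρ ≤ s → ∀ Q : ℂ → ℂ,
      DifferentiableOn ℂ Q (ball b ρ) → (∀ y ∈ ball b ρ, y ∈ A → Q y ∈ A) →
      (∀ y ∈ ball b ρ, ‖deriv Q y - deriv (S.word w) y‖ ≤ η * ‖deriv (S.word w) b‖) →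
      ‖Q b - S.word w b‖ ≤ η * ρ * ‖deriv (S.word w) b‖ →
      EqOn Q (S.word w) (ball b ρ) := by
  obtain ⟨H, hH1, hH⟩ := h.exists_comparable hA
  obtain ⟨κ, hκ, hgap⟩ := h.exists_gap hA hSSC
  have hc0 := h.c_pos
  have hc1 := h.c_le_one
  have hH0 : 0 < H := by linarith
  set η := κ * c / (32 * H ^ 2) with hη
  have hη0 : 0 < η := by positivity
  have hηH : 32 * H ^ 2 * η = κ * c := by rw [hη]; field_simp
  refine ⟨η, hη0, ?_⟩
  intro w b hb ρ hρ hρs Q hQd hQA hQ' hQb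
  have hball : ball b ρ ⊆ closedBall b s :=
    ball_subset_closedBall.trans (closedBall_subset_closedBall hρs)
  have hballΩ : ball b ρ ⊆ S.Ω := hball.trans (h.closedBall_subset b hb)
  set p := ‖deriv (S.word w) b‖ with hp
  have hp0 : 0 < p := norm_pos_iff.2 (deriv_word_ne_zero w (hA.subset hb))
  set f : ℂ → ℂ := fun y => Q y - S.word w y with hf
  have hQat : ∀ y ∈ ball b ρ, DifferentiableAt ℂ Q y := fun y hy =>
    hQd.differentiableAt (isOpen_ball.mem_nhds hy)
  have hfd : ∀ y ∈ ball b ρ,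
      HasDerivAt f (deriv Q y - deriv (S.word w) y) y := fun y hy =>
    (hQat y hy).hasDerivAt.sub (differentiableAt_word w (hballΩ hy)).hasDerivAt
  have hlip : ∀ y ∈ ball b ρ, ∀ z ∈ ball b ρ, ‖f z - f y‖ ≤ η * p * ‖z - y‖ :=
    fun y hy z hz => Convex.norm_image_sub_le_of_norm_hasDerivWithin_le
      (fun u hu => (hfd u hu).hasDerivWithinAt) hQ' (convex_ball b ρ) hy hz
  have hzero : ∀ y₀ ∈ A, y₀ ∈ ball b (ρ / 2) → f y₀ = 0 := by
    intro y₀ hy₀A hy₀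
    by_contra hne
    set E := ‖f y₀‖ with hE
    have hE0 : 0 < E := norm_pos_iff.2 hne
    have hy₀ρ : y₀ ∈ ball b ρ := ball_subset_ball (by linarith) hy₀
    have hy₀' : ‖y₀ - b‖ < ρ / 2 := mem_ball_iff_norm.1 hy₀
    have hEle : E ≤ 2 * η * ρ * p := by
      have h1 := hlip b (mem_ball_self hρ) y₀ hy₀ρ
      have h2 := norm_le_norm_add_norm_sub' (f y₀) (f b)
      have h3 : η * p * ‖y₀ - b‖ ≤ η * p * ρ := by gcongr; linarith
      have h4 : ‖f b‖ ≤ η * ρ * p := hQb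
      linarith
    obtain ⟨t, τ, hcode⟩ := hA.exists_isCoding hy₀A
    set D : ℕ → ℝ := fun n => ‖deriv (S.word (τ n)) (t n)‖ with hD
    have hex : ∃ n, κ * p * D n ≤ 4 * H * E := by
      obtain ⟨k, hk⟩ := hcode.exists_deriv_le h (show 0 < 4 * H * E / (κ * p) by positivity)
      exact ⟨k, (le_div_iff₀' (by positivity)).1 (hk k le_rfl)⟩
    have hH2 : H ≤ H ^ 2 := by nlinarith
    obtain ⟨n, hn, hn1⟩ : ∃ n, 4 * H * E < κ * p * D n ∧ κ * p * D (n + 1) ≤ 4 * H * E := by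
      classical
      have hspec := Nat.find_spec hex
      rcases Nat.eq_zero_or_pos (Nat.find hex) with h0 | hpos
      · exfalso
        rw [h0] at hspec
        have hD0 : D 0 = 1 := by simp [hD, hcode.w_zero, deriv_word_nil]
        rw [hD0, mul_one] at hspec
        have h1 : 4 * H * E ≤ 4 * H * (2 * η * ρ * p) := by gcongr
        have h2 : η * ρ ≤ η * 1 := by gcongr; linarith
        have h3 : κ * c ≤ κ * 1 := by gcongr
        have h4 : 8 * (H * η) * 1 < κ := by
          have : H * η ≤ H ^ 2 * η := by gcongr
          have : 0 < H * η := by positivity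
          linarith
        have h5 : 4 * H * (2 * η * ρ * p) ≤ (8 * (H * η) * 1) * p := by
          have : H * p * (η * ρ) ≤ H * p * (η * 1) := by gcongr
          linarith
        have h6 : (8 * (H * η) * 1) * p < κ * p := by gcongr
        linarith
      · refine ⟨Nat.find hex - 1, not_le.1 (Nat.find_min hex (by omega)), ?_⟩
        rwa [Nat.sub_add_cancel hpos]
    have hcD : c * D n ≤ D (n + 1) := hcode.mul_deriv_le hA h n
    have hDn0 : 0 ≤ D n := norm_nonneg _
    have hkey : κ * c * p * D n ≤ 4 * H * E := by
      have : κ * p * (c * D n) ≤ κ * p * D (n + 1) := by gcongr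
      linarith
    have hηD : η * p * (H * D n) ≤ E / 8 := by
      have h1 : 32 * H * (η * p * (H * D n)) ≤ 32 * H * (E / 8) := by
        calc _ = 32 * H ^ 2 * η * p * D n := by ring
          _ = κ * c * p * D n := by rw [hηH]
          _ ≤ 4 * H * E := hkey
          _ = _ := by ring
      exact le_of_mul_le_mul_left h1 (by positivity)
    have hHD : H * D n ≤ ρ / 4 := by
      have h1 : η * p * (H * D n) ≤ η * p * (ρ / 4) := by
        linarith
      exact le_of_mul_le_mul_left h1 (by positivity)
    have hcyl : ∀ u ∈ A, ‖S.word (τ n) u - y₀‖ ≤ H * D n := by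
      intro u hu
      have := (hH (τ n) u hu (t n) (hcode.mem n)).2
      rwa [hcode.word_eq] at this
    have hcylball : ∀ u ∈ A, S.word (τ n) u ∈ ball b ρ := by
      intro u hu
      rw [mem_ball_iff_norm]
      have := norm_sub_le_norm_sub_add_norm_sub (S.word (τ n) u) y₀ b
      linarith [hcyl u hu]
    have hclose : ∀ u ∈ A, ‖f (S.word (τ n) u) - f y₀‖ ≤ E / 2 := by
      intro u hu
      refine (hlip y₀ hy₀ρ _ (hcylball u hu)).trans ?_
      have : η * p * ‖S.word (τ n) u - y₀‖ ≤ η * p * (H * D n) := by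
        gcongr
        exact hcyl u hu
      linarith
    have hstep : ∀ u ∈ A, ∃ v ∈ A,
        S.word w (S.word (τ n) v) = S.word w (S.word (τ n) u) + f (S.word (τ n) u) := by
      intro u hu
      have hyA := hA.word_mapsTo (τ n) hu
      have hyball := hcylball u hu
      have hQy := hQA _ hyball hyA
      have hmem : Q (S.word (τ n) u) ∈ S.word (w ++ τ n) '' A := by
        by_contra hnot
        have h1 := hgap (w ++ τ n) u hu _ hQy hnot
        rw [deriv_word_append _ _ (hA.subset hu), norm_mul, word_append] at h1
        have h2 : ‖S.word w (S.word (τ n) u) - Q (S.word (τ n) u)‖ ≤ 3 / 2 * E := by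
          rw [norm_sub_rev]
          have h3 := norm_le_norm_add_norm_sub' (f (S.word (τ n) u)) (f y₀)
          have h4 := hclose u hu
          change ‖f (S.word (τ n) u)‖ ≤ _
          linarith
        have h3 := h.half_le_norm_deriv hb (hball hyball) w
        have h4 := (hH (τ n) (t n) (hcode.mem n) u hu).1
        have h5 : κ * (1 / 2 * p * (D n / H)) ≤
            κ * (‖deriv (S.word w) (S.word (τ n) u)‖ * ‖deriv (S.word (τ n)) u‖) := by
          have : D n / H ≤ ‖deriv (S.word (τ n)) u‖ := (div_le_iff₀' hH0).2 h4
          gcongr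
        have h6 : 2 * E < κ * (1 / 2 * p * (D n / H)) := by
          rw [show κ * (1 / 2 * p * (D n / H)) = κ * p * D n / (2 * H) by field_simp,
            lt_div_iff₀ (by positivity)]
          linarith
        have h7 : κ * (‖deriv (S.word w) (S.word (τ n) u)‖ * ‖deriv (S.word (τ n)) u‖) ≤
          ‖S.word w (S.word (τ n) u) - Q (S.word (τ n) u)‖ := h1
        linarith
      obtain ⟨v, hv, hvQ⟩ := hmem
      refine ⟨v, hv, ?_⟩
      rw [word_append] at hvQ
      change S.word w (S.word (τ n) v) = _ at hvQ
      rw [hvQ, hf]; ring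
    have hmarch : ∀ j : ℕ, ∃ u ∈ A,
        (j : ℝ) / 2 ≤ ((S.word w (S.word (τ n) u) - S.word w y₀) / f y₀).re := by
      intro j
      induction j with
      | zero => exact ⟨t n, hcode.mem n, by simp [hcode.word_eq]⟩
      | succ j ih =>
        obtain ⟨u, hu, hj⟩ := ih
        obtain ⟨v, hv, hvu⟩ := hstep u hu
        refine ⟨v, hv, ?_⟩
        have h1 : (S.word w (S.word (τ n) v) - S.word w y₀) / f y₀ =
            (S.word w (S.word (τ n) u) - S.word w y₀) / f y₀ + 1 +
              (f (S.word (τ n) u) - f y₀) / f y₀ := by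
          rw [hvu]; field_simp; ring
        have h2 : ‖(f (S.word (τ n) u) - f y₀) / f y₀‖ ≤ 1 / 2 := by
          rw [norm_div, div_le_iff₀ hE0]
          linarith [hclose u hu]
        have h3 := (abs_le.1 ((Complex.abs_re_le_norm _).trans h2)).1
        rw [h1, Complex.add_re, Complex.add_re, Complex.one_re]
        push_cast
        linarith
    obtain ⟨R, hR⟩ := hA.2.1.isBounded.exists_norm_le
    obtain ⟨j, hj⟩ := exists_nat_gt (2 * (2 * R / E))
    obtain ⟨u, hu, huj⟩ := hmarch j
    have h1 : ‖(S.word w (S.word (τ n) u) - S.word w y₀) / f y₀‖ ≤ 2 * R / E := by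
      rw [norm_div]
      gcongr
      refine (norm_sub_le _ _).trans ?_
      linarith [hR _ (hA.word_mapsTo w (hA.word_mapsTo (τ n) hu)), hR _ (hA.word_mapsTo w hy₀A)]
    have h2 := (Complex.re_le_norm _).trans h1
    linarith
  have hfan : AnalyticOnNhd ℂ f (ball b ρ) :=
    (hQd.sub ((differentiableOn_word w).mono hballΩ)).analyticOnNhd isOpen_ball
  have hfreq : ∃ᶠ z in nhdsWithin b {b}ᶜ, f z = 0 := by
    refine ((hA.frequently_mem hA2 hb).and_eventually
      (nhdsWithin_le_nhds (ball_mem_nhds b (half_pos hρ)))).mono ?_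
    rintro z ⟨hzA, hz⟩
    exact hzero z hzA hz
  have := hfan.eqOn_zero_of_preconnected_of_frequently_eq_zero
    (convex_ball b ρ).isPreconnected (mem_ball_self hρ) hfreq
  exact fun z hz => sub_eq_zero.1 (this hz)

end HolIFS

theorem IsCompact.exists_dist_lt_of_forall_mem {α : Type*} [PseudoMetricSpace α] {X : Set α}
    (hX : IsCompact X) {δ : ℝ} (hδ : 0 < δ) :
    ∃ N : ℕ, 1 ≤ N ∧ ∀ u : ℕ → α, (∀ k, u k ∈ X) →
      ∃ k₁ k₂, k₁ < k₂ ∧ k₂ ≤ N ∧ dist (u k₁) (u k₂) < δ := by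
  obtain ⟨T, -, hT, hcov⟩ := hX.finite_cover_balls (half_pos hδ)
  refine ⟨hT.toFinset.card + 1, by omega, fun u hu => ?_⟩
  have hex : ∀ k, ∃ x ∈ T, dist (u k) x < δ / 2 := fun k => by
    simpa using hcov (hu k)
  choose x hxT hx using hex
  obtain ⟨i, hi, j, hj, hij, hxij⟩ := Finset.exists_ne_map_eq_of_card_lt_of_maps_to
    (s := Finset.range (hT.toFinset.card + 1)) (t := hT.toFinset) (f := x) (by simp)
    (fun k _ => by simpa using hxT k)
  have hd : dist (u i) (u j) < δ := by
    have h1 := dist_triangle_right (u i) (u j) (x i)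
    have h2 := hx j
    rw [← hxij] at h2
    linarith [hx i]
  rw [Finset.mem_range] at hi hj
  rcases lt_or_gt_of_ne hij with hlt | hlt
  · exact ⟨i, j, hlt, by omega, hd⟩
  · exact ⟨j, i, hlt, by omega, by rwa [dist_comm]⟩

/-- Stopping times at which a null sequence with bounded decay ratio passes a geometric scale. -/
theorem exists_monotone_stopping {D : ℕ → ℝ} {c μ : ℝ} (hc1 : c ≤ 1) (hμ : 0 < μ)
    (hμ1 : μ < 1) (hD0 : ∀ n, 0 < D n) (hD : ∀ n, c * D n ≤ D (n + 1))
    (hlim : ∀ ε > 0, ∃ k, ∀ n, k ≤ n → D n ≤ ε) (n₀ : ℕ) :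
    ∃ N : ℕ → ℕ, Monotone N ∧ ∀ k, n₀ ≤ N k ∧ D (N k) ≤ μ ^ k * D n₀ ∧
      c * (μ ^ k * D n₀) ≤ D (N k) := by
  classical
  have hex : ∀ k : ℕ, ∃ n, n₀ ≤ n ∧ D n ≤ μ ^ k * D n₀ := by
    intro k
    obtain ⟨m, hm⟩ := hlim (μ ^ k * D n₀) (mul_pos (pow_pos hμ k) (hD0 n₀))
    exact ⟨max m n₀, le_max_right _ _, hm _ (le_max_left _ _)⟩
  refine ⟨fun k => Nat.find (hex k), ?_, fun k => ⟨(Nat.find_spec (hex k)).1,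
    (Nat.find_spec (hex k)).2, ?_⟩⟩
  · intro k l hkl
    refine Nat.find_min' (hex k) ⟨(Nat.find_spec (hex l)).1, (Nat.find_spec (hex l)).2.trans ?_⟩
    exact mul_le_mul_of_nonneg_right (pow_le_pow_of_le_one hμ.le hμ1.le hkl) (hD0 n₀).le
  · have hspec := Nat.find_spec (hex k)
    have hpos : 0 < μ ^ k * D n₀ := mul_pos (pow_pos hμ k) (hD0 n₀)
    rcases hspec.1.eq_or_lt with heq | hlt
    · have h1 : μ ^ k * D n₀ ≤ D n₀ :=
        mul_le_of_le_one_left (hD0 n₀).le (pow_le_one₀ hμ.le hμ1.le)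
      have h2 : c * (μ ^ k * D n₀) ≤ μ ^ k * D n₀ := mul_le_of_le_one_left hpos.le hc1
      change c * (μ ^ k * D n₀) ≤ D (Nat.find (hex k))
      rw [← heq]
      exact h2.trans h1
    · have hmin := Nat.find_min (hex k) (m := Nat.find (hex k) - 1) (by omega)
      have h1 : μ ^ k * D n₀ < D (Nat.find (hex k) - 1) := by
        by_contra hle
        exact hmin ⟨by omega, not_lt.1 hle⟩
      have h2 := hD (Nat.find (hex k) - 1)
      rw [Nat.sub_add_cancel (by omega)] at h2
      rcases le_or_gt 0 c with hc | hc
      · exact (mul_le_mul_of_nonneg_left h1.le hc).trans h2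
      · exact (mul_neg_of_neg_of_pos hc hpos).le.trans (hD0 _).le

theorem IsSymmetryOn.eventually_iterate {K : Set ℂ} {h : ℂ → ℂ} {a : ℂ} {r : ℝ} (hr : 0 < r)
    (hh : IsSymmetryOn K (ball a r) h) (ha : h a = a) (l : ℕ) :
    AnalyticAt ℂ h^[l] a ∧ ∀ᶠ z in nhds a, z ∈ K → h^[l] z ∈ K := by
  have hball : ball a r ∈ nhds a := ball_mem_nhds a hr
  have han : AnalyticAt ℂ h a := hh.1.analyticAt hball
  induction l with
  | zero => exact ⟨analyticAt_id, Filter.Eventually.of_forall fun _ hz => hz⟩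
  | succ l ih =>
    constructor
    · rw [Function.iterate_succ]
      exact AnalyticAt.comp (by rw [ha]; exact ih.1) han
    · have htend : Filter.Tendsto h (nhds a) (nhds a) := by
        simpa [ContinuousAt, ha] using han.continuousAt
      filter_upwards [htend.eventually ih.2, hball] with z h1 h2 hz
      exact h1 ((hh.2 z h2).1 hz)

theorem IsSymmetryOn.exists_ball_iterate {K : Set ℂ} {h : ℂ → ℂ} {a : ℂ} {r : ℝ} (hr : 0 < r)
    (hh : IsSymmetryOn K (ball a r) h) (ha : h a = a) (hd : deriv h a ≠ 0) (N : ℕ) {ε : ℝ}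
    (hε : 0 < ε) :
    ∃ ρ > (0 : ℝ), ∀ l ≤ N, ∀ z ∈ ball a ρ, DifferentiableAt ℂ h^[l] z ∧
      (z ∈ K → h^[l] z ∈ K) ∧ ‖deriv h^[l] z - deriv h a ^ l‖ ≤ ε * ‖deriv h a ^ l‖ := by
  have hev : ∀ᶠ z in nhds a, ∀ l ∈ Iic N, DifferentiableAt ℂ h^[l] z ∧
      (z ∈ K → h^[l] z ∈ K) ∧ ‖deriv h^[l] z - deriv h a ^ l‖ ≤ ε * ‖deriv h a ^ l‖ := by
    rw [Filter.eventually_all_finite (finite_Iic N)]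
    intro l _
    obtain ⟨han, hK⟩ := hh.eventually_iterate hr ha l
    have hda : deriv h^[l] a = deriv h a ^ l :=
      (HasDerivAt.iterate a (hh.1.differentiableAt (ball_mem_nhds a hr)).hasDerivAt ha l).deriv
    have hcont := han.deriv.continuousAt
    rw [ContinuousAt, hda] at hcont
    have hpos : 0 < ε * ‖deriv h a ^ l‖ := mul_pos hε (norm_pos_iff.2 (pow_ne_zero l hd))
    filter_upwards [han.eventually_analyticAt, hK, hcont.eventually (closedBall_mem_nhds _ hpos)]
      with z h1 h2 h3
    exact ⟨h1.differentiableAt, h2, mem_closedBall_iff_norm.1 h3⟩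
  obtain ⟨ρ, hρ, hρ'⟩ := Metric.eventually_nhds_iff_ball.1 hev
  exact ⟨ρ, hρ, fun l hl z hz => hρ' z hz l hl⟩

theorem norm_mul_sub_le_of_relative_error {d g Λ p₁ p₂ q : ℂ} {ε : ℝ} (hε0 : 0 ≤ ε)
    (hε : ε ≤ 1 / 10) (hd : ‖d - Λ‖ ≤ ε * ‖Λ‖) (hg : ‖g - p₁‖ ≤ 2 * ε * ‖p₁‖)
    (hΛ : ‖Λ * p₁ - p₂‖ ≤ ε * ‖p₂‖) (hq : ‖q - p₂‖ ≤ ε * ‖p₂‖) :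
    ‖d * g - q‖ ≤ 6 * ε * ‖p₂‖ := by
  have e : d * g - q = (d - Λ) * g + Λ * (g - p₁) + ((Λ * p₁ - p₂) - (q - p₂)) := by ring
  have h1 : ‖d * g - q‖ ≤ ‖d - Λ‖ * ‖g‖ + ‖Λ‖ * ‖g - p₁‖ + (‖Λ * p₁ - p₂‖ + ‖q - p₂‖) := by
    rw [e, ← norm_mul, ← norm_mul]
    exact norm_add₃_le.trans (by gcongr; exact norm_sub_le _ _)
  have hgn : ‖g‖ ≤ (1 + 2 * ε) * ‖p₁‖ := by
    linarith [norm_le_norm_add_norm_sub' g p₁]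
  have hX : ‖Λ‖ * ‖p₁‖ ≤ (1 + ε) * ‖p₂‖ := by
    rw [← norm_mul]
    linarith [norm_le_norm_add_norm_sub' (Λ * p₁) p₂]
  have h2 : ‖d - Λ‖ * ‖g‖ ≤ ε * ‖Λ‖ * ((1 + 2 * ε) * ‖p₁‖) := by gcongr
  have h3 : ‖Λ‖ * ‖g - p₁‖ ≤ ‖Λ‖ * (2 * ε * ‖p₁‖) := by gcongr
  have h4 : ε * (3 + 2 * ε) * (‖Λ‖ * ‖p₁‖) ≤ ε * (3 + 2 * ε) * ((1 + ε) * ‖p₂‖) := by gcongr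
  have h5 : (3 + 2 * ε) * (1 + ε) ≤ 4 := by nlinarith
  have h6 : ε * ‖p₂‖ * ((3 + 2 * ε) * (1 + ε)) ≤ ε * ‖p₂‖ * 4 := by gcongr
  linarith

namespace HolIFS

variable {S : HolIFS} {A : Set ℂ}

/-- Every point `a` of the attractor has an address `v` and a tail `u` such that `b` and `g_u b` are
`δ`-close and, for some bounded `l`, `Λ ^ l` times the derivative of `g_v` at `g_u b` is nearly the
derivative of `g_{vu}` at `b`. -/
theorem BoundedDistortion.exists_close_data {s C θ c B : ℝ}
    (h : S.BoundedDistortion A s C θ c B) (hA : S.IsAttractor A) {δ : ℝ} (hδ : 0 < δ) :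
    ∃ K : ℕ, 1 ≤ K ∧ ∀ a ∈ A, ∀ Λ : ℂ, 0 < ‖Λ‖ → ‖Λ‖ < 1 → ∀ n₀ : ℕ,
      ∃ l, 1 ≤ l ∧ l ≤ K ∧ ∃ v u : List (Fin S.m), n₀ ≤ v.length ∧ ∃ b ∈ A,
        S.word v (S.word u b) = a ∧ ‖S.word u b - b‖ < δ ∧
        c * ‖Λ ^ l * deriv (S.word v) (S.word u b) - deriv (S.word (v ++ u)) b‖ ≤
          δ * ‖deriv (S.word (v ++ u)) b‖ := by
  obtain ⟨K, hK1, hK⟩ := (hA.2.1.prod (isCompact_closedBall (0 : ℂ) 1)).exists_dist_lt_of_forall_mem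
    hδ
  refine ⟨K, hK1, fun a ha Λ hΛ0 hΛ1 n₀ => ?_⟩
  obtain ⟨t, w, hcode⟩ := hA.exists_isCoding ha
  set p : ℕ → ℂ := fun n => deriv (S.word (w n)) (t n) with hp
  have hpne : ∀ n, p n ≠ 0 := fun n => deriv_word_ne_zero _ (hA.subset (hcode.mem n))
  have hΛne : Λ ≠ 0 := norm_pos_iff.1 hΛ0
  obtain ⟨N, hNmono, hN⟩ := exists_monotone_stopping (D := fun n => ‖p n‖) h.c_le_one hΛ0 hΛ1
    (fun n => norm_pos_iff.2 (hpne n)) (hcode.mul_deriv_le hA h)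
    (fun ε hε => hcode.exists_deriv_le h hε) n₀
  set q : ℕ → ℂ := fun k => p (N k) / (Λ ^ k * p n₀) with hq
  have hpq : ∀ k, p (N k) = q k * (Λ ^ k * p n₀) := fun k =>
    (div_mul_cancel₀ _ (mul_ne_zero (pow_ne_zero k hΛne) (hpne n₀))).symm
  have hpos : ∀ k, 0 < ‖Λ‖ ^ k * ‖p n₀‖ := fun k =>
    mul_pos (pow_pos hΛ0 k) (norm_pos_iff.2 (hpne n₀))
  obtain ⟨k₁, k₂, hlt, hk₂, hdist⟩ := hK (fun k => (t (N k), q k)) fun k =>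
    ⟨hcode.mem _, by
      rw [mem_closedBall_zero_iff, hq, norm_div, norm_mul, norm_pow, div_le_one (hpos k)]
      exact (hN k).2.1⟩
  obtain ⟨hd1, hd2⟩ := max_lt_iff.1 (Prod.dist_eq.symm.trans_lt hdist)
  obtain ⟨u, hu, hut⟩ := hcode.exists_append (hNmono hlt.le)
  refine ⟨k₂ - k₁, by omega, by omega, w (N k₁), u, ?_, t (N k₂), hcode.mem _, ?_, ?_, ?_⟩
  · rw [hcode.length]
    exact (hN k₁).1
  · rw [hut, hcode.word_eq]
  · rw [hut, ← dist_eq_norm]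
    exact hd1
  · rw [hut, ← hu]
    change c * ‖Λ ^ (k₂ - k₁) * p (N k₁) - p (N k₂)‖ ≤ δ * ‖p (N k₂)‖
    have e : Λ ^ (k₂ - k₁) * p (N k₁) - p (N k₂) = (q k₁ - q k₂) * (Λ ^ k₂ * p n₀) := by
      rw [hpq k₁, hpq k₂, ← Nat.sub_add_cancel hlt.le, pow_add, Nat.add_sub_cancel]
      ring
    rw [e, norm_mul, norm_mul, norm_pow, mul_left_comm]
    rw [dist_eq_norm] at hd2
    have hc := h.c_pos
    have h3 := (hN k₂).2.2
    have := hpos k₂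
    calc ‖q k₁ - q k₂‖ * (c * (‖Λ‖ ^ k₂ * ‖p n₀‖))
        ≤ δ * (c * (‖Λ‖ ^ k₂ * ‖p n₀‖)) := by gcongr
      _ ≤ δ * ‖p (N k₂)‖ := by gcongr

/-- An iterate of a symmetry agrees with the word map `g_{vu}` after precomposition with `g_v`. -/
theorem exists_iterate_comp_eqOn (hA : S.IsAttractor A) (hA2 : A.Nontrivial) (hSSC : S.SSC A) :
    ∃ K : ℕ, 1 ≤ K ∧ ∀ a ∈ A, ∀ r > (0 : ℝ), ∀ f : ℂ → ℂ, IsSymmetryOn A (ball a r) f → f a = a →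
      0 < ‖deriv f a‖ → ‖deriv f a‖ < 1 → ∃ l, 1 ≤ l ∧ l ≤ K ∧
        ∃ v u : List (Fin S.m), v ≠ [] ∧ ∃ U, IsOpen U ∧ U ⊆ S.Ω ∧ ∃ x ∈ U, S.word v x = a ∧
          ∀ y ∈ U, f^[l] (S.word v y) = S.word v (S.word u y) := by
  obtain ⟨s, C, θ, c, B, h⟩ := exists_boundedDistortion hA
  replace h := h.mono (lt_min h.s_pos one_pos) (min_le_left s 1)
  set s' := min s 1
  have hs1 : s' ≤ 1 := min_le_right s 1
  have hs0 := h.s_pos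
  have hc0 := h.c_pos
  have hB0 := h.B_nonneg
  obtain ⟨η, hη, hrigid⟩ := h.exists_eqOn_word hs1 hA hA2 hSSC
  obtain ⟨ε, hε0, hε1, hεη⟩ : ∃ ε > 0, ε ≤ 1 / 10 ∧ 6 * ε ≤ η :=
    ⟨min (1 / 10) (η / 6), by positivity, min_le_left _ _, by
      linarith [min_le_right (1 / 10) (η / 6)]⟩
  obtain ⟨ρ, hρ0, hρs, hBρ⟩ : ∃ ρ > 0, 2 * ρ ≤ s' ∧ B * ρ ≤ ε := by
    refine ⟨min (s' / 2) (ε / (B + 1)), by positivity, by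
      linarith [min_le_left (s' / 2) (ε / (B + 1))], ?_⟩
    have h1 := min_le_right (s' / 2) (ε / (B + 1))
    rw [le_div_iff₀ (by positivity)] at h1
    have h2 : 0 < min (s' / 2) (ε / (B + 1)) := by positivity
    linarith
  obtain ⟨δ, hδ0, hδρ, hδc, hδη⟩ : ∃ δ > 0, δ ≤ ρ ∧ δ ≤ c * ε ∧ 2 * δ ≤ η * ρ :=
    ⟨min ρ (min (c * ε) (η * ρ / 2)), by positivity, min_le_left _ _,
      (min_le_right _ _).trans (min_le_left _ _), by
        linarith [(min_le_right ρ (min (c * ε) (η * ρ / 2))).trans (min_le_right _ _)]⟩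
  obtain ⟨K, hK1, hK⟩ := h.exists_close_data hA hδ0
  refine ⟨K, hK1, fun a ha r hr f hf hfa hΛ0 hΛ1 => ?_⟩
  obtain ⟨ρf, hρf, hiter⟩ := hf.exists_ball_iterate hr hfa (norm_pos_iff.1 hΛ0) K hε0
  obtain ⟨n₀, hn₀⟩ := h.exists_pow_le (half_pos hρf)
  obtain ⟨l, hl1, hlK, v, u, hv, b, hb, hva, hub, hmult⟩ := hK a ha _ hΛ0 hΛ1 (n₀ + 1)
  set a₁ := S.word u b
  set p₁ := deriv (S.word v) a₁
  set p₂ := deriv (S.word (v ++ u)) b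
  set Λ := deriv f a
  have ha₁ : a₁ ∈ A := hA.word_mapsTo u hb
  have hΛp : ‖Λ ^ l * p₁ - p₂‖ ≤ ε * ‖p₂‖ := by
    have h1 : δ * ‖p₂‖ ≤ c * ε * ‖p₂‖ := by gcongr
    rw [mul_assoc] at h1
    exact le_of_mul_le_mul_left (hmult.trans h1) hc0
  have hballs : ball b ρ ⊆ closedBall b s' :=
    ball_subset_closedBall.trans (closedBall_subset_closedBall (by linarith))
  have hballΩ : ball b ρ ⊆ S.Ω := hballs.trans (h.closedBall_subset b hb)
  have hy₁ : ∀ y ∈ ball b ρ, ‖y - a₁‖ ≤ 2 * ρ := fun y hy => by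
    have h1 := mem_ball_iff_norm.1 hy
    have h2 := norm_sub_le_norm_sub_add_norm_sub y b a₁
    rw [norm_sub_rev b a₁] at h2
    linarith
  have hy₁s : ∀ y ∈ ball b ρ, y ∈ closedBall a₁ s' := fun y hy =>
    mem_closedBall_iff_norm.2 ((hy₁ y hy).trans hρs)
  have hmaps : ∀ y ∈ ball b ρ, S.word v y ∈ ball a ρf := fun y hy => by
    have h1 := h.norm_word_sub_le ha₁ (hy₁s y hy) v
    have h2 : C * θ ^ v.length * ‖y - a₁‖ ≤ ρf / 2 * 1 := by
      gcongr
      · exact hn₀ _ (by omega)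
      · exact (hy₁ y hy).trans (hρs.trans hs1)
    rw [hva] at h1
    exact mem_ball_iff_norm.2 (by linarith)
  set Q : ℂ → ℂ := fun y => f^[l] (S.word v y) with hQ
  have hQd : ∀ y ∈ ball b ρ, HasDerivAt Q (deriv f^[l] (S.word v y) * deriv (S.word v) y) y :=
    fun y hy => (hiter l hlK _ (hmaps y hy)).1.hasDerivAt.comp y
      (differentiableAt_word v (hballΩ hy)).hasDerivAt
  have hP : ∀ y ∈ ball b ρ, ‖deriv (S.word (v ++ u)) y - p₂‖ ≤ ε * ‖p₂‖ := fun y hy => by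
    refine (h.distortion b hb y (hballs hy) _).trans ?_
    have h1 := (mem_ball_iff_norm.1 hy).le
    have h2 : B * ‖y - b‖ ≤ ε := le_trans (by gcongr) hBρ
    gcongr
  have hQP : ∀ y ∈ ball b ρ, ‖deriv Q y - deriv (S.word (v ++ u)) y‖ ≤ 6 * ε * ‖p₂‖ := by
    intro y hy
    rw [(hQd y hy).deriv]
    refine norm_mul_sub_le_of_relative_error hε0.le hε1 (hiter l hlK _ (hmaps y hy)).2.2 ?_ hΛp
      (hP y hy)
    refine (h.distortion a₁ ha₁ y (hy₁s y hy) v).trans ?_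
    have h1 := hy₁ y hy
    have h2 : B * ‖y - a₁‖ ≤ B * (2 * ρ) := by gcongr
    have h3 : B * ‖y - a₁‖ ≤ 2 * ε := by linarith
    gcongr
  have hQ' : ∀ y ∈ ball b ρ, ‖deriv Q y‖ ≤ 2 * ‖p₂‖ := fun y hy => by
    have h1 := hQP y hy
    have h2 := hP y hy
    have h3 := norm_le_norm_add_norm_sub' (deriv Q y) (deriv (S.word (v ++ u)) y)
    have h4 := norm_le_norm_add_norm_sub' (deriv (S.word (v ++ u)) y) p₂
    have h5 : ε * ‖p₂‖ ≤ 1 / 10 * ‖p₂‖ := by gcongr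
    linarith [norm_nonneg p₂]
  have ha₁b : a₁ ∈ ball b ρ := mem_ball_iff_norm.2 (hub.trans_le hδρ)
  have hbb : b ∈ ball b ρ := mem_ball_self hρ0
  have hQb : ‖Q b - S.word (v ++ u) b‖ ≤ η * ρ * ‖p₂‖ := by
    have h1 : S.word (v ++ u) b = Q a₁ := by
      rw [word_append, Function.comp_apply, hQ]
      simp only [hva, a₁]
      rw [Function.iterate_fixed hfa]
    have h2 := (convex_ball b ρ).norm_image_sub_le_of_norm_deriv_le
      (fun y hy => (hQd y hy).differentiableAt) hQ' ha₁b hbb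
    rw [h1, norm_sub_rev b a₁] at *
    refine h2.trans ?_
    have h3 : 2 * ‖p₂‖ * ‖a₁ - b‖ ≤ 2 * ‖p₂‖ * δ := by gcongr
    have h4 : 2 * δ * ‖p₂‖ ≤ η * ρ * ‖p₂‖ := by gcongr
    linarith
  have heq := hrigid (v ++ u) b hb ρ hρ0 (by linarith) Q
    (fun y hy => (hQd y hy).differentiableAt.differentiableWithinAt)
    (fun y hy hyA => (hiter l hlK _ (hmaps y hy)).2.1 (hA.word_mapsTo v hyA))
    (fun y hy => (hQP y hy).trans (by gcongr)) hQb
  refine ⟨l, hl1, hlK, v, u, ?_, ball b ρ, isOpen_ball, hballΩ, a₁, ha₁b, hva, fun y hy => ?_⟩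
  · rintro rfl
    simp at hv
  · rw [← Function.comp_apply (f := S.word v), ← word_append]
    exact heq hy

theorem image_word_mem_nhds (v : List (Fin S.m)) {U : Set ℂ} (hU : IsOpen U) (hUΩ : U ⊆ S.Ω)
    {x : ℂ} (hx : x ∈ U) : S.word v '' U ∈ nhds (S.word v x) := by
  have han : AnalyticAt ℂ (S.word v) x :=
    (differentiableOn_word v).analyticAt (S.hopen.mem_nhds (hUΩ hx))
  rw [← han.hasStrictDerivAt.map_nhds_eq (deriv_word_ne_zero v (hUΩ hx))]
  exact Filter.image_mem_map (hU.mem_nhds hx)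

end HolIFS

/-- Corollary: given the attractor `A` of a holomorphic IFS `G` with the SSC and `r > 0`,
there is `K` (depending only on `r` and `G`) such that for any local symmetry
`h : B(a, r) → ℂ` of `A` with an attracting fixed point `a ∈ A` there are `l ≤ K` and
finite words `v, ṽ` with `h^l = g_v ∘ g_ṽ ∘ g_v⁻¹` on some ball around `a`
(encoded pointwise: for `z` near `a` there is `x ∈ Ω` with `g_v x = z` and
`h^[l] z = g_v (g_ṽ x)`). -/
theorem stmt_17 (G : HolIFS) (A : Set ℂ)
    (hA : G.IsAttractor A) (hA2 : A.Nontrivial) (hSSC : G.SSC A)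
    (r : ℝ) (hr : 0 < r) :
    ∃ K : ℕ, 1 ≤ K ∧
      ∀ a ∈ A, ∀ h : ℂ → ℂ,
        IsSymmetryOn A (Metric.ball a r) h → h a = a →
        0 < ‖deriv h a‖ → ‖deriv h a‖ < 1 →
        ∃ l : ℕ, 1 ≤ l ∧ l ≤ K ∧
          ∃ v vt : List (Fin G.m), v ≠ [] ∧ vt ≠ [] ∧
            ∃ ε > (0 : ℝ), ∀ z ∈ Metric.ball a ε, ∃ x ∈ G.Ω,
              G.word v x = z ∧ h^[l] z = G.word v (G.word vt x) := by
  obtain ⟨K, hK1, hK⟩ := HolIFS.exists_iterate_comp_eqOn hA hA2 hSSC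
  refine ⟨K, hK1, fun a ha h hh hfix h0 h1 => ?_⟩
  obtain ⟨l, hl1, hlK, v, u, hv, U, hU, hUΩ, x, hx, hxa, heq⟩ := hK a ha r hr h hh hfix h0 h1
  obtain ⟨ε, hε, hball⟩ := Metric.mem_nhds_iff.1 (HolIFS.image_word_mem_nhds v hU hUΩ hx)
  rw [hxa] at hball
  refine ⟨l, hl1, hlK, v, u, hv, ?_, ε, hε, fun z hz => ?_⟩
  · rintro rfl
    have hid : h^[l] =ᶠ[nhds a] id := by
      filter_upwards [Metric.ball_mem_nhds a hε] with z hz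
      obtain ⟨y, hy, rfl⟩ := hball hz
      exact heq y hy
    have hd : deriv h^[l] a = deriv h a ^ l :=
      (HasDerivAt.iterate a (hh.1.differentiableAt (ball_mem_nhds a hr)).hasDerivAt hfix l).deriv
    rw [hid.deriv_eq, deriv_id] at hd
    have hlt : ‖deriv h a ^ l‖ < 1 := by
      rw [norm_pow]
      exact pow_lt_one₀ h0.le h1 (by omega)
    rw [← hd, norm_one] at hlt
    exact lt_irrefl _ hlt
  · obtain ⟨y, hy, rfl⟩ := hball hz
    exact ⟨y, hUΩ hy, rfl, heq y hy⟩
end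
end

section
/- Let R be a holomorphic map defined in a neighborhood of 0 in ℂ with R(0) = 0 and 0 < |R'(0)| < 1. Then for every l ∈ ℕ there are precisely l distinct germs at 0 of holomorphic maps g with g(0) = 0 such that the l-th iterate g^l equals R as a germ at 0. -/
open Filter

noncomputable section

open scoped Topology

theorem AnalyticAt.exists_eq_add_id_mul {f : ℂ → ℂ} (hf : AnalyticAt ℂ f 0) :
    ∃ S : ℂ → ℂ, AnalyticAt ℂ S 0 ∧ S 0 = deriv f 0 ∧ ∀ z, f z = f 0 + z * S z := by
  obtain ⟨p, hp⟩ := hf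
  refine ⟨dslope f 0, hp.has_fpower_series_dslope_fslope.analyticAt, dslope_same f 0, fun z ↦ ?_⟩
  have h := sub_smul_dslope f 0 z
  simp only [sub_zero, smul_eq_mul] at h
  rw [h]; ring

theorem AnalyticAt.exists_norm_le_mul_and_norm_sub_le_sq {R : ℂ → ℂ} (hR : AnalyticAt ℂ R 0)
    (hR0 : R 0 = 0) {c : ℝ} (hc : ‖deriv R 0‖ < c) :
    ∃ r > 0, ∃ C ≥ 0, ∀ z ∈ Metric.ball (0 : ℂ) r, DifferentiableAt ℂ R z ∧ ‖R z‖ ≤ c * ‖z‖ ∧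
      ‖R z - deriv R 0 * z‖ ≤ C * ‖z‖ ^ 2 := by
  obtain ⟨S, hS, hS0, hRS⟩ := hR.exists_eq_add_id_mul
  obtain ⟨T, hT, -, hST⟩ := hS.exists_eq_add_id_mul
  have hS' : ∀ᶠ z in 𝓝 0, ‖S z‖ < c :=
    hS.continuousAt.norm.eventually_lt continuousAt_const (by simpa [hS0] using hc)
  have hT' : ∀ᶠ z in 𝓝 0, ‖T z‖ < ‖T 0‖ + 1 :=
    hT.continuousAt.norm.eventually_lt continuousAt_const (by linarith)
  obtain ⟨r, hr, hball⟩ := Metric.eventually_nhds_iff_ball.1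
    (hS'.and (hT'.and hR.eventually_analyticAt))
  refine ⟨r, hr, ‖T 0‖ + 1, by positivity, fun z hz ↦ ?_⟩
  obtain ⟨h₁, h₂, h₃⟩ := hball z hz
  refine ⟨h₃.differentiableAt, ?_, ?_⟩
  · rw [hRS z, hR0, zero_add, norm_mul, mul_comm]
    gcongr
  · have : R z - deriv R 0 * z = T z * z ^ 2 := by
      rw [hRS z, hST z, hR0, hS0]; ring
    rw [this, norm_mul, norm_pow]
    gcongr

/-- Existence of the Koenigs linearizing coordinate at an attracting fixed point. -/
theorem exists_koenigs {R : ℂ → ℂ} (hR : AnalyticAt ℂ R 0) (hR0 : R 0 = 0)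
    (h1 : 0 < ‖deriv R 0‖) (h2 : ‖deriv R 0‖ < 1) :
    ∃ φ : ℂ → ℂ, AnalyticAt ℂ φ 0 ∧ φ 0 = 0 ∧ deriv φ 0 = 1 ∧
      ∀ᶠ z in 𝓝 0, φ (R z) = deriv R 0 * φ z := by
  obtain ⟨c, hc, hc'⟩ := exists_between (show ‖deriv R 0‖ < √‖deriv R 0‖ from
    Real.lt_sqrt_of_sq_lt (by nlinarith))
  have hc0 : 0 < c := h1.trans hc
  have hcsq : c ^ 2 < ‖deriv R 0‖ := (Real.lt_sqrt hc0.le).1 hc'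
  have hc1 : c < 1 := by nlinarith
  obtain ⟨r, hr, C, hC, H⟩ := hR.exists_norm_le_mul_and_norm_sub_le_sq hR0 hc
  generalize hlam : deriv R 0 = lam at *
  have hlam0 : lam ≠ 0 := norm_pos_iff.1 h1
  have hmaps : Set.MapsTo R (Metric.ball 0 r) (Metric.ball 0 r) := fun z hz ↦ by
    have := (H z hz).2.1
    simp only [mem_ball_zero_iff] at hz ⊢
    nlinarith [norm_nonneg z]
  have hiter (n : ℕ) : ∀ z ∈ Metric.ball (0 : ℂ) r,
      R^[n] z ∈ Metric.ball (0 : ℂ) r ∧ ‖R^[n] z‖ ≤ c ^ n * ‖z‖ := by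
    intro z hz
    refine ⟨hmaps.iterate n hz, ?_⟩
    induction n with
    | zero => simp
    | succ n ih =>
      rw [Function.iterate_succ_apply']
      refine (H _ (hmaps.iterate n hz)).2.1.trans ?_
      rw [pow_succ', mul_assoc]
      gcongr
  have hdiff (n : ℕ) : DifferentiableOn ℂ R^[n] (Metric.ball 0 r) :=
    DifferentiableOn.iterate (fun z hz ↦ (H z hz).1.differentiableWithinAt) hmaps n
  set F : ℕ → ℂ → ℂ := fun n z ↦ (R (R^[n] z) - lam * R^[n] z) / lam ^ (n + 1) with hF
  set q : ℝ := c ^ 2 / ‖lam‖ with hq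
  have hq1 : q < 1 := (div_lt_one h1).2 hcsq
  have hq0 : 0 ≤ q := by positivity
  have hbound (n : ℕ) (z : ℂ) (hz : z ∈ Metric.ball (0 : ℂ) r) :
      ‖F n z‖ ≤ C / ‖lam‖ * q ^ n * ‖z‖ ^ 2 := by
    obtain ⟨hm, hn⟩ := hiter n z hz
    have : C * ‖R^[n] z‖ ^ 2 ≤ C * (c ^ n * ‖z‖) ^ 2 := by gcongr
    calc ‖F n z‖ ≤ C * (c ^ n * ‖z‖) ^ 2 / ‖lam‖ ^ (n + 1) := by
          rw [hF]
          simp only [norm_div, norm_pow]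
          gcongr
          exact (H _ hm).2.2.trans this
      _ = _ := by rw [hq, div_pow]; field_simp; ring
  have hgeom : Summable fun n ↦ C / ‖lam‖ * q ^ n :=
    (summable_geometric_of_lt_one hq0 hq1).mul_left _
  have hsum (z : ℂ) (hz : z ∈ Metric.ball (0 : ℂ) r) : Summable fun n ↦ F n z :=
    .of_norm_bounded (hgeom.mul_right _) fun n ↦ hbound n z hz
  have hball : Metric.ball (0 : ℂ) r ∈ 𝓝 0 := Metric.ball_mem_nhds _ hr
  have hG : DifferentiableOn ℂ (fun z ↦ ∑' n, F n z) (Metric.ball 0 r) := by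
    refine Complex.differentiableOn_tsum_of_summable_norm (hgeom.mul_right (r ^ 2)) (fun n ↦ ?_)
      Metric.isOpen_ball fun n z hz ↦ (hbound n z hz).trans ?_
    · simp only [hF, ← Function.iterate_succ_apply' R n]
      exact ((hdiff (n + 1)).sub ((hdiff n).const_mul lam)).div_const _
    · have := (mem_ball_zero_iff.1 hz).le
      gcongr
  have hF0 (n : ℕ) : F n 0 = 0 := by
    simpa using hbound n 0 (Metric.mem_ball_self hr)
  have hG' : HasDerivAt (fun z ↦ ∑' n, F n z) 0 0 := by
    rw [hasDerivAt_iff_isLittleO_nhds_zero]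
    simp only [zero_add, hF0, tsum_zero, sub_zero, smul_zero]
    refine Asymptotics.IsBigO.trans_isLittleO (g := fun z : ℂ ↦ z ^ 2)
      (.of_bound (∑' n, C / ‖lam‖ * q ^ n) ?_) (Asymptotics.isLittleO_pow_id one_lt_two)
    filter_upwards [hball] with z hz
    rw [norm_pow, ← tsum_mul_right]
    exact tsum_of_norm_bounded (hgeom.mul_right _).hasSum fun n ↦ hbound n z hz
  refine ⟨fun z ↦ z + ∑' n, F n z, ?_, by simp [hF0], ?_, ?_⟩
  · exact analyticAt_id.add (hG.analyticAt hball)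
  · simpa using ((hasDerivAt_id' (0 : ℂ)).fun_add hG').deriv
  · filter_upwards [hball] with z hz
    have hshift (n : ℕ) : F n (R z) = lam * F (n + 1) z := by
      simp only [hF, Function.iterate_succ_apply]
      field_simp
      ring
    have h0 : F 0 z = (R z - lam * z) / lam := by simp [hF]
    rw [(hsum z hz).tsum_eq_zero_add, h0]
    simp only [hshift, tsum_mul_left]
    field_simp
    ring

/-- A solution of the linearized equation at an attracting fixed point is determined by its
derivative. -/
theorem eventually_eq_zero_of_comp_eq_mul {R d : ℂ → ℂ} (hR : AnalyticAt ℂ R 0) (hR0 : R 0 = 0)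
    (h1 : 0 < ‖deriv R 0‖) (h2 : ‖deriv R 0‖ < 1) (hd : AnalyticAt ℂ d 0)
    (hd1 : deriv d 0 = 0) (hdR : ∀ᶠ z in 𝓝 0, d (R z) = deriv R 0 * d z) :
    ∀ᶠ z in 𝓝 0, d z = 0 := by
  by_contra hne
  obtain ⟨n, u, hu, hu0, hdu⟩ := hd.exists_eventuallyEq_pow_smul_nonzero_iff.2 hne
  simp only [sub_zero, smul_eq_mul] at hdu
  obtain ⟨S, hS, hS0, hRS⟩ := hR.exists_eq_add_id_mul
  simp only [hR0, zero_add] at hRS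
  have hRt : Tendsto R (𝓝 0) (𝓝 0) := by simpa [ContinuousAt, hR0] using hR.continuousAt
  have hlim : deriv R 0 ^ n * u 0 = deriv R 0 * u 0 := by
    have hA : Tendsto (fun z ↦ S z ^ n * u (R z)) (𝓝[≠] 0) (𝓝 (deriv R 0 ^ n * u 0)) := by
      have hS' : Tendsto S (𝓝 0) (𝓝 (deriv R 0)) := hS0 ▸ hS.continuousAt
      exact ((hS'.pow n).mul (hu.continuousAt.tendsto.comp hRt)).mono_left nhdsWithin_le_nhds
    have hB : Tendsto (fun z ↦ deriv R 0 * u z) (𝓝[≠] 0) (𝓝 (deriv R 0 * u 0)) :=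
      (hu.continuousAt.tendsto.const_mul _).mono_left nhdsWithin_le_nhds
    refine tendsto_nhds_unique (hA.congr' ?_) hB
    filter_upwards [nhdsWithin_le_nhds hdR, nhdsWithin_le_nhds hdu,
      nhdsWithin_le_nhds (hRt.eventually hdu), self_mem_nhdsWithin] with z h₁ h₂ h₃ hz
    rw [h₃, h₂, hRS z, mul_pow] at h₁
    rw [← hRS z] at h₁
    refine mul_left_cancel₀ (pow_ne_zero n hz) ?_
    linear_combination h₁
  have hpow : ‖deriv R 0‖ ^ n = ‖deriv R 0‖ ^ 1 := by
    rw [pow_one, ← norm_pow, mul_right_cancel₀ hu0 hlim]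
  have hn : n = 1 := pow_right_injective₀ h1 h2.ne hpow
  subst hn
  refine hu0 ?_
  have h : HasDerivAt (fun z ↦ z ^ 1 * u z) (u 0) 0 := by
    simpa using (hasDerivAt_id' (0 : ℂ)).fun_mul hu.differentiableAt.hasDerivAt
  rw [← h.deriv, ← EventuallyEq.deriv_eq hdu, hd1]

theorem eventuallyEq_of_comp_eventuallyEq {φ a b : ℂ → ℂ} (hφ : AnalyticAt ℂ φ 0)
    (hφ' : deriv φ 0 ≠ 0) (ha : Tendsto a (𝓝 0) (𝓝 0)) (hb : Tendsto b (𝓝 0) (𝓝 0))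
    (h : ∀ᶠ z in 𝓝 0, φ (a z) = φ (b z)) : a =ᶠ[𝓝 0] b := by
  have hinv := hφ.hasStrictDerivAt.eventually_left_inverse hφ'
  filter_upwards [ha.eventually hinv, hb.eventually hinv, h] with z h₁ h₂ h₃
  rw [← h₁, ← h₂, h₃]

theorem eventually_semiconj_mul_iterate {φ g : ℂ → ℂ} {μ : ℂ} (hg : Tendsto g (𝓝 0) (𝓝 0))
    (h : ∀ᶠ z in 𝓝 0, φ (g z) = μ * φ z) (n : ℕ) :
    ∀ᶠ z in 𝓝 0, φ (g^[n] z) = μ ^ n * φ z := by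
  induction n with
  | zero => simp
  | succ n ih =>
    filter_upwards [hg.eventually ih, h] with z h₁ h₂
    rw [Function.iterate_succ_apply, h₁, h₂, pow_succ, mul_assoc]

theorem exists_injective_pow_eq {l : ℕ} (hl : l ≠ 0) {a : ℂ} (ha : a ≠ 0) :
    ∃ m : Fin l → ℂ, Function.Injective m ∧ (∀ s, m s ^ l = a) ∧
      ∀ x, x ^ l = a → ∃ s, x = m s := by
  obtain ⟨b, hb⟩ := IsAlgClosed.exists_pow_nat_eq a (Nat.pos_of_ne_zero hl)
  have hb0 : b ≠ 0 := by rintro rfl; exact ha (by rw [← hb, zero_pow hl])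
  have hζ := Complex.isPrimitiveRoot_exp l hl
  generalize Complex.exp _ = ζ at hζ
  refine ⟨fun s ↦ b * ζ ^ (s : ℕ), fun s t hst ↦ ?_, fun s ↦ ?_, fun x hx ↦ ?_⟩
  · exact Fin.ext (hζ.pow_inj s.2 t.2 (mul_left_cancel₀ hb0 hst))
  · rw [mul_pow, hb, pow_right_comm, hζ.pow_eq_one, one_pow, mul_one]
  · have : NeZero l := ⟨hl⟩
    obtain ⟨i, hi, hx'⟩ := hζ.eq_pow_of_pow_eq_one (show (x / b) ^ l = 1 by
      rw [div_pow, hx, hb, div_self ha])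
    exact ⟨⟨i, hi⟩, by simp only [hx']; field_simp⟩

/-- Claim (Koenigs): let `R` be holomorphic near `0` with `R 0 = 0` and
`0 < |R'(0)| < 1`. Then for every `l ≥ 1` there are precisely `l` distinct germs at `0`
of holomorphic maps `g` with `g 0 = 0` whose `l`-th iterate equals `R` as a germ at `0`. -/
theorem stmt_19 (R : ℂ → ℂ) (hR : AnalyticAt ℂ R 0) (hR0 : R 0 = 0)
    (h1 : 0 < ‖deriv R 0‖) (h2 : ‖deriv R 0‖ < 1)
    (l : ℕ) (hl : 1 ≤ l) :
    ∃ gs : Fin l → ℂ → ℂ,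
      (∀ s, AnalyticAt ℂ (gs s) 0 ∧ gs s 0 = 0 ∧ (gs s)^[l] =ᶠ[nhds 0] R) ∧
      (∀ s s' : Fin l, s ≠ s' → ¬ (gs s =ᶠ[nhds 0] gs s')) ∧
      (∀ h : ℂ → ℂ, AnalyticAt ℂ h 0 → h 0 = 0 → h^[l] =ᶠ[nhds 0] R →
        ∃ s, h =ᶠ[nhds 0] gs s) := by
  obtain ⟨φ, hφ, hφ0, hφ1, hφR⟩ := exists_koenigs hR hR0 h1 h2
  have hφ' : deriv φ 0 ≠ 0 := by simp [hφ1]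
  have tendsto_zero {f : ℂ → ℂ} (hf : AnalyticAt ℂ f 0) (hf0 : f 0 = 0) :
      Tendsto f (𝓝 0) (𝓝 0) := by simpa [ContinuousAt, hf0] using hf.continuousAt
  obtain ⟨m, hm, hml, hm'⟩ := exists_injective_pow_eq (Nat.one_le_iff_ne_zero.1 hl)
    (norm_pos_iff.1 h1)
  set σ := hφ.hasStrictDerivAt.localInverse φ _ 0 hφ'
  have hσ : AnalyticAt ℂ σ 0 := by simpa [hφ0] using hφ.analyticAt_localInverse hφ'
  have hφσ : ∀ᶠ w in 𝓝 0, φ (σ w) = w := by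
    simpa [hφ0] using hφ.hasStrictDerivAt.eventually_right_inverse hφ'
  have hσ0 : σ 0 = 0 := by
    have := (hφ.hasStrictDerivAt.eventually_left_inverse hφ').self_of_nhds
    rwa [hφ0] at this
  set g : Fin l → ℂ → ℂ := fun s z ↦ σ (m s * φ z) with hgdef
  have hmφ (s : Fin l) : AnalyticAt ℂ (fun z ↦ m s * φ z) 0 := analyticAt_const.mul hφ
  have hmφ0 (s : Fin l) : m s * φ 0 = 0 := by simp [hφ0]
  have hg (s : Fin l) : AnalyticAt ℂ (g s) 0 :=
    AnalyticAt.fun_comp (by rwa [hmφ0]) (hmφ s)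
  have hg0 (s : Fin l) : g s 0 = 0 := by simp [hgdef, hφ0, hσ0]
  have hgφ (s : Fin l) : ∀ᶠ z in 𝓝 0, φ (g s z) = m s * φ z :=
    (tendsto_zero (hmφ s) (hmφ0 s)).eventually hφσ
  refine ⟨g, fun s ↦ ⟨hg s, hg0 s, ?_⟩, fun s s' hss hgg ↦ hss (hm ?_), fun h hh hh0 hhl ↦ ?_⟩
  · have hgt := tendsto_zero (hg s) (hg0 s)
    refine eventuallyEq_of_comp_eventuallyEq hφ hφ' (hgt.iterate l) (tendsto_zero hR hR0) ?_
    filter_upwards [eventually_semiconj_mul_iterate hgt (hgφ s) l, hφR] with z h₁ h₂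
    rw [h₁, h₂, hml]
  · have heq : (fun z ↦ m s * φ z) =ᶠ[𝓝 0] fun z ↦ m s' * φ z := by
      filter_upwards [hgφ s, hgφ s', hgg] with z h₁ h₂ h₃
      rw [← h₁, ← h₂, h₃]
    have := heq.deriv_eq
    simpa [deriv_const_mul_field, hφ1] using this
  · have hht := tendsto_zero hh hh0
    have hhd : HasDerivAt h (deriv h 0) 0 := hh.differentiableAt.hasDerivAt
    obtain ⟨s, hs⟩ := hm' (deriv h 0) (by
      rw [← hhl.deriv_eq, (hhd.iterate 0 hh0 l).deriv])
    have hcomm : ∀ᶠ z in 𝓝 0, h (R z) = R (h z) := by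
      filter_upwards [hhl, hht.eventually hhl] with z h₁ h₂
      rw [← h₁, ← h₂, ← Function.iterate_succ_apply, Function.iterate_succ_apply']
    have hφh : AnalyticAt ℂ (fun z ↦ φ (h z)) 0 := AnalyticAt.fun_comp (by rwa [hh0]) hh
    have hφhd : HasDerivAt (fun z ↦ φ (h z)) (deriv φ 0 * deriv h 0) 0 :=
      HasDerivAt.comp 0 (by rw [hh0]; exact hφ.differentiableAt.hasDerivAt) hhd
    have hzero := eventually_eq_zero_of_comp_eq_mul hR hR0 h1 h2 (hφh.sub (hmφ s))
      (by
        rw [(hφhd.sub (hφ.differentiableAt.hasDerivAt.const_mul (m s))).deriv, hφ1, hs]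
        ring)
      (by
        filter_upwards [hcomm, hφR, hht.eventually hφR] with z h₁ h₂ h₃
        simp only [Pi.sub_apply]
        rw [h₁, h₂, h₃]
        ring)
    refine ⟨s, eventuallyEq_of_comp_eventuallyEq hφ hφ' hht (tendsto_zero (hg s) (hg0 s)) ?_⟩
    filter_upwards [hzero, hgφ s] with z h₁ h₂
    rw [h₂]
    exact sub_eq_zero.1 h₁
end
end
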